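/- Consider the RGV ensemble of rate R, composition Q_X, distance function d and threshold Δ, and assume the rate condition holds with some parameter δ > 0. Let P_{XX'} ∈ 𝒬(Q_X) with d(P_{XX'}) > Δ. Then for every s ∈ ℝ with s ≠ [2R−I_P(X;X')]_+: if s < [2R−I_P(X;X')]_+ then P[N(P_{XX'}) ≥ e^{ns}] ≐ exp{−n·[I_P(X;X')−2R]_+}, and if s > [2R−I_P(X;X')]_+ then P[N(P_{XX'}) ≥ e^{ns}] decays super-exponentially in n. -/

import Mathlib

open Filter Finset
open scoped Classical

noncomputable section

namespace RGV

/-- A probability distribution on a finite type. -/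
def IsDist {α : Type} [Fintype α] (p : α → ℝ) : Prop :=
  (∀ a, 0 ≤ p a) ∧ ∑ a, p a = 1

/-- `p` is an `n`-type: all probabilities are integer multiples of `1/n`. -/
def IsTypeDist {α : Type} (n : ℕ) (p : α → ℝ) : Prop :=
  ∀ a, ∃ k : ℕ, p a * n = k

/-- Empirical distribution of a sequence. -/
def emp {α : Type} [Fintype α] (n : ℕ) (x : Fin n → α) : α → ℝ :=
  fun a => ((Finset.univ.filter fun i => x i = a).card : ℝ) / n

/-- Joint empirical distribution of a pair of sequences. -/
def emp2 {α β : Type} [Fintype α] [Fintype β] (n : ℕ) (x : Fin n → α) (y : Fin n → β) :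
    α × β → ℝ :=
  fun ab => ((Finset.univ.filter fun i => x i = ab.1 ∧ y i = ab.2).card : ℝ) / n

/-- The type class of a composition `Q`. -/
def typeClass {α : Type} [Fintype α] (n : ℕ) (Q : α → ℝ) : Finset (Fin n → α) :=
  Finset.univ.filter fun x => emp n x = Q

/-- The pair type class of a joint type `P`. -/
def typeClass2 {α : Type} [Fintype α] (n : ℕ) (P : α × α → ℝ) :
    Finset ((Fin n → α) × (Fin n → α)) :=
  Finset.univ.filter fun xx => emp2 n xx.1 xx.2 = P

/-- `P` is a joint distribution on `α × α` with both marginals equal to `Q`. -/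
def Joint {α : Type} [Fintype α] (Q : α → ℝ) (P : α × α → ℝ) : Prop :=
  IsDist P ∧ (∀ a, ∑ b, P (a, b) = Q a) ∧ (∀ b, ∑ a, P (a, b) = Q b)

/-- `d` is a distance function: continuous and symmetric. -/
def IsDistance {α : Type} [Fintype α] (d : (α × α → ℝ) → ℝ) : Prop :=
  Continuous d ∧ ∀ P : α × α → ℝ, d (fun p => P (p.2, p.1)) = d P

/-- Mutual information of a joint distribution (natural logarithms). -/
def mutInf {α β : Type} [Fintype α] [Fintype β] (P : α × β → ℝ) : ℝ :=
  ∑ p : α × β, P p * Real.log (P p / ((∑ b, P (p.1, b)) * (∑ a, P (a, p.2))))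

/-- Positive part `[t]₊`. -/
def pos (t : ℝ) : ℝ := max t 0

/-- Number of codewords at blocklength `n` and rate `R`. -/
def Mof (R : ℝ) (n : ℕ) : ℕ := ⌈Real.exp (n * R)⌉₊

/-- The feasible set for the `i`-th codeword given the previous ones. -/
def feasible {α : Type} [Fintype α] (n : ℕ) (Q : α → ℝ) (d : (α × α → ℝ) → ℝ) (Δ : ℝ)
    {M : ℕ} (c : Fin M → Fin n → α) (i : Fin M) : Finset (Fin n → α) :=
  (typeClass n Q).filter fun z => ∀ j, j < i → Δ < d (emp2 n z (c j))

/-- The probability that the RGV construction outputs the codebook `c`. -/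
def rgvProb {α : Type} [Fintype α] (n : ℕ) (Q : α → ℝ) (d : (α × α → ℝ) → ℝ) (Δ : ℝ)
    {M : ℕ} (c : Fin M → Fin n → α) : ℝ :=
  ∏ i : Fin M,
    if c i ∈ feasible n Q d Δ c i then ((feasible n Q d Δ c i).card : ℝ)⁻¹ else 0

/-- Expectation over the RGV ensemble. -/
def expect {α : Type} [Fintype α] (n : ℕ) (Q : α → ℝ) (d : (α × α → ℝ) → ℝ) (Δ : ℝ)
    (M : ℕ) (f : (Fin M → Fin n → α) → ℝ) : ℝ :=
  ∑ c : Fin M → Fin n → α, rgvProb n Q d Δ c * f c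

/-- Probability of an event over the RGV ensemble. -/
def prob {α : Type} [Fintype α] (n : ℕ) (Q : α → ℝ) (d : (α × α → ℝ) → ℝ) (Δ : ℝ)
    (M : ℕ) (S : (Fin M → Fin n → α) → Prop) : ℝ :=
  ∑ c : Fin M → Fin n → α, if S c then rgvProb n Q d Δ c else 0

/-- `W` is a (discrete memoryless) channel. -/
def IsChannel {α β : Type} [Fintype β] (W : α → β → ℝ) : Prop := ∀ a, IsDist (W a)

/-- The product (memoryless) extension of the channel. -/
def Wn {α β : Type} (n : ℕ) (W : α → β → ℝ) (x : Fin n → α) (y : Fin n → β) : ℝ :=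
  ∏ i, W (x i) (y i)

/-- GLD error probability of a codebook. -/
def Pe {α β : Type} [Fintype α] [Fintype β] (n : ℕ) (W : α → β → ℝ)
    (g : (α × β → ℝ) → ℝ) {M : ℕ} (c : Fin M → Fin n → α) : ℝ :=
  (M : ℝ)⁻¹ * ∑ m : Fin M, ∑ m' ∈ Finset.univ.erase m, ∑ y : Fin n → β,
    Wn n W (c m) y * Real.exp ((n : ℝ) * g (emp2 n (c m') y)) /
      ∑ m'' : Fin M, Real.exp ((n : ℝ) * g (emp2 n (c m'') y))

/-- Marginal `P_{XY}` induced by `P_{XX'}` and the conditional law `V = P_{Y|XX'}`. -/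
def PXY {α β : Type} [Fintype α] [Fintype β] (P : α × α → ℝ) (V : α × α → β → ℝ) :
    α × β → ℝ :=
  fun ay => ∑ b, P (ay.1, b) * V (ay.1, b) ay.2

/-- Marginal `P_{X'Y}`. -/
def PXpY {α β : Type} [Fintype α] [Fintype β] (P : α × α → ℝ) (V : α × α → β → ℝ) :
    α × β → ℝ :=
  fun bY => ∑ a, P (a, bY.1) * V (a, bY.1) bY.2

/-- Output marginal `P_Y`. -/
def PYof {α β : Type} [Fintype α] [Fintype β] (P : α × α → ℝ) (V : α × α → β → ℝ) :
    β → ℝ :=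
  fun y => ∑ p : α × α, P p * V p y

/-- Conditional divergence `D(P_{Y|X} ‖ W | Q)`. -/
def condDiv {α β : Type} [Fintype α] [Fintype β] (Q : α → ℝ) (W : α → β → ℝ)
    (P : α × α → ℝ) (V : α × α → β → ℝ) : ℝ :=
  ∑ a, ∑ y, PXY P V (a, y) * Real.log (PXY P V (a, y) / (Q a * W a y))

/-- Conditional mutual information `I(X';Y|X)`. -/
def cmi {α β : Type} [Fintype α] [Fintype β] (P : α × α → ℝ) (V : α × α → β → ℝ) : ℝ :=
  ∑ a, ∑ b, ∑ y, P (a, b) * V (a, b) y *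
    Real.log (P (a, b) * V (a, b) y * (∑ b', P (a, b')) /
      (P (a, b) * PXY P V (a, y)))

/-- The joint distribution on `α × β` induced by `P_Y` and a reverse channel `V'`. -/
def jointOf {α β : Type} (PY : β → ℝ) (V' : β → α → ℝ) : α × β → ℝ :=
  fun ay => PY ay.2 * V' ay.2 ay.1

/-- The quantity `α(R, P_Y)`. -/
def alphaF {α β : Type} [Fintype α] [Fintype β] (Q : α → ℝ) (g : (α × β → ℝ) → ℝ)
    (R : ℝ) (PY : β → ℝ) : ℝ :=
  sSup { v | ∃ V' : β → α → ℝ, (∀ y, IsDist (V' y)) ∧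
    (∀ a, ∑ y, PY y * V' y a = Q a) ∧ mutInf (jointOf PY V') ≤ R ∧
    v = g (jointOf PY V') - mutInf (jointOf PY V') } + R

/-- The exponent `Γ(P_{XX'}, R)`. -/
def Gamma {α β : Type} [Fintype α] [Fintype β] (Q : α → ℝ) (W : α → β → ℝ)
    (g : (α × β → ℝ) → ℝ) (P : α × α → ℝ) (R : ℝ) : ℝ :=
  sInf { v | ∃ V : α × α → β → ℝ, (∀ p, IsDist (V p)) ∧
    v = condDiv Q W P V + cmi P V +
      pos (max (g (PXY P V)) (alphaF Q g R (PYof P V)) - g (PXpY P V)) }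

/-- The quantity `β(R, P_Y)`. -/
def betaF {α β : Type} [Fintype α] [Fintype β] (Q : α → ℝ) (g : (α × β → ℝ) → ℝ)
    (R : ℝ) (PY : β → ℝ) : ℝ :=
  sSup { v | ∃ V' : β → α → ℝ, (∀ y, IsDist (V' y)) ∧
    (∀ a, ∑ y, PY y * V' y a = Q a) ∧
    v = g (jointOf PY V') + pos (R - mutInf (jointOf PY V')) }

/-- The exponent `Λ(P_{XX'}, R)`. -/
def Lambda {α β : Type} [Fintype α] [Fintype β] (Q : α → ℝ) (W : α → β → ℝ)
    (g : (α × β → ℝ) → ℝ) (P : α × α → ℝ) (R : ℝ) : ℝ :=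
  sInf { v | ∃ V : α × α → β → ℝ, (∀ p, IsDist (V p)) ∧
    v = condDiv Q W P V + cmi P V + betaF Q g R (PYof P V) - g (PXpY P V) }

/-- The candidate value of the typical random coding exponent of the RGV ensemble. -/
def EtrcVal {α β : Type} [Fintype α] [Fintype β] (Q : α → ℝ) (W : α → β → ℝ)
    (g : (α × β → ℝ) → ℝ) (d : (α × α → ℝ) → ℝ) (Δ R : ℝ) : ℝ :=
  sInf { v | ∃ P : α × α → ℝ, Joint Q P ∧ mutInf P ≤ 2 * R ∧ Δ < d P ∧
    v = Gamma Q W g P R + mutInf P - R }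

/-- The expurgated exponent. -/
def Eex {α β : Type} [Fintype α] [Fintype β] (Q : α → ℝ) (W : α → β → ℝ)
    (g : (α × β → ℝ) → ℝ) (R : ℝ) : ℝ :=
  sInf { v | ∃ P : α × α → ℝ, Joint Q P ∧ mutInf P ≤ R ∧
    v = Gamma Q W g P R + mutInf P - R }

/-- The expurgated exponent of the RGV ensemble. -/
def EexRgv {α β : Type} [Fintype α] [Fintype β] (Q : α → ℝ) (W : α → β → ℝ)
    (g : (α × β → ℝ) → ℝ) (d : (α × α → ℝ) → ℝ) (Δ R : ℝ) : ℝ :=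
  sInf { v | ∃ P : α × α → ℝ, Joint Q P ∧ Δ < d P ∧ mutInf P ≤ R ∧
    v = Gamma Q W g P R + mutInf P - R }

/-- The rate condition at blocklength `n` with parameter `δ`
(the minimum over an empty collection of joint types being `+∞`). -/
def RateCond {α : Type} [Fintype α] (n : ℕ) (Q : α → ℝ) (d : (α × α → ℝ) → ℝ)
    (Δ R δ : ℝ) : Prop :=
  ((R : ℝ) : EReal) ≤
    sInf { v : EReal | ∃ P : α × α → ℝ, Joint Q P ∧ IsTypeDist n P ∧ d P ≤ Δ ∧
      v = ((mutInf P : ℝ) : EReal) } - (((2 * δ : ℝ)) : EReal)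

/-- Type enumerator: the number of ordered pairs of distinct codewords
with joint empirical distribution `P`. -/
def Nenum {α : Type} [Fintype α] (n : ℕ) (P : α × α → ℝ) {M : ℕ}
    (c : Fin M → Fin n → α) : ℕ :=
  ((Finset.univ : Finset (Fin M × Fin M)).filter fun mm =>
    mm.1 ≠ mm.2 ∧ emp2 n (c mm.1) (c mm.2) = P).card

/-- Normalized log of a probability (exponential rate), valued in `EReal`. -/
def lrate (n : ℕ) (p : ℝ) : EReal :=
  if p ≤ 0 then ⊥ else ((Real.log p / n : ℝ) : EReal)

/-- Normalized iterated-log rate (double-exponential decay rate), valued in `EReal`. -/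
def drate (n : ℕ) (p : ℝ) : EReal :=
  if p ≤ 0 then ⊤ else if 1 ≤ p then ⊥
  else ((Real.log (-Real.log p) / n : ℝ) : EReal)

/-- `δ_n = e^{-nδ}/(1-e^{-nδ})`. -/
def deltan (n : ℕ) (δ : ℝ) : ℝ := Real.exp (-(n * δ)) / (1 - Real.exp (-(n * δ)))


/-- Blocklength sequence: the multiples of the denominator `D` of the composition. -/
def nseq (D t : ℕ) : ℕ := D * (t + 1)

/-- The normalized expected log error probability `-(1/n) E[log P_e(C_n)]`. -/
def Expnt {α β : Type} [Fintype α] [Fintype β] (n : ℕ) (Q : α → ℝ)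
    (d : (α × α → ℝ) → ℝ) (Δ : ℝ) (W : α → β → ℝ) (g : (α × β → ℝ) → ℝ) (R : ℝ) : ℝ :=
  -(expect n Q d Δ (Mof R n) (fun c => Real.log (Pe n W g c)) / n)

/-- Ratio of type class sizes `|T(P)| / |T(Q)|²`. -/
def Lsize {α : Type} [Fintype α] (n : ℕ) (Q : α → ℝ) (P : α × α → ℝ) : ℝ :=
  ((typeClass2 n P).card : ℝ) / ((typeClass n Q).card : ℝ) ^ 2

end RGV

namespace RGV

section Sequential

variable {X : Type} (T : Finset X) (good : X → X → Prop)

/-- The points of `T` compatible with every point of `c`. -/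
def nextSet {m : ℕ} (c : Fin m → X) : Finset X := T.filter fun z => ∀ j, good z (c j)

/-- The points of `T` compatible with the points of `c` preceding position `i`. -/
def feasSet {M : ℕ} (c : Fin M → X) (i : Fin M) : Finset X :=
  T.filter fun z => ∀ j, j < i → good z (c j)

/-- The uniform weight on a finite set. -/
def unifWt (S : Finset X) (z : X) : ℝ := if z ∈ S then (S.card : ℝ)⁻¹ else 0

/-- The law of the sequential construction drawing each point uniformly from the feasible set. -/
def seqWt {M : ℕ} (c : Fin M → X) : ℝ := ∏ i, unifWt (feasSet T good c i) (c i)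

lemma unifWt_nonneg (S : Finset X) (z : X) : 0 ≤ unifWt S z := by
  unfold unifWt; split_ifs <;> positivity

lemma feasSet_snoc_castSucc {m : ℕ} (c : Fin m → X) (z : X) (i : Fin m) :
    feasSet T good (Fin.snoc c z : Fin (m + 1) → X) i.castSucc = feasSet T good c i := by
  unfold feasSet
  refine Finset.filter_congr fun y _ => ?_
  constructor
  · intro h j hj
    simpa using h j.castSucc (by simpa using hj)
  · intro h j hj
    induction j using Fin.lastCases with
    | last => exact absurd hj (by simp [Fin.le_last])
    | cast j => simpa using h j (by simpa using hj)

lemma feasSet_snoc_last {m : ℕ} (c : Fin m → X) (z : X) :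
    feasSet T good (Fin.snoc c z : Fin (m + 1) → X) (Fin.last m) = nextSet T good c := by
  unfold feasSet nextSet
  refine Finset.filter_congr fun y _ => ?_
  constructor
  · intro h j
    simpa using h j.castSucc (Fin.castSucc_lt_last j)
  · intro h j hj
    induction j using Fin.lastCases with
    | last => exact absurd hj (lt_irrefl _)
    | cast j => simpa using h j

lemma seqWt_snoc {m : ℕ} (c : Fin m → X) (z : X) :
    seqWt T good (Fin.snoc c z : Fin (m + 1) → X) =
      seqWt T good c * unifWt (nextSet T good c) z := by
  unfold seqWt
  rw [Fin.prod_univ_castSucc]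
  simp [feasSet_snoc_castSucc, feasSet_snoc_last]

lemma seqWt_nonneg {M : ℕ} (c : Fin M → X) : 0 ≤ seqWt T good c :=
  Finset.prod_nonneg fun _ _ => unifWt_nonneg _ _

lemma mem_of_seqWt_ne_zero {M : ℕ} {c : Fin M → X} (h : seqWt T good c ≠ 0) (i : Fin M) :
    c i ∈ T := by
  have := Finset.prod_ne_zero_iff.1 h i (Finset.mem_univ i)
  unfold unifWt at this
  split_ifs at this with hi
  · exact (Finset.mem_filter.1 hi).1
  · exact absurd rfl this

variable {T good}

/-- If every point of `T` excludes at most `K` points, at least half of `T` remains available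
after `m ≤ |T| / (2K)` draws. -/
lemma card_le_two_mul_card_nextSet {K m : ℕ}
    (hK : ∀ y ∈ T, (T.filter fun z => ¬ good z y).card ≤ K) (hm : 2 * m * K ≤ T.card)
    {c : Fin m → X} (hc : ∀ i, c i ∈ T) : T.card ≤ 2 * (nextSet T good c).card := by
  have h1 : T ⊆ nextSet T good c ∪ Finset.univ.biUnion fun j => T.filter fun z => ¬ good z (c j) := by
    intro z hz
    by_cases h : ∀ j, good z (c j)
    · exact Finset.mem_union_left _ (Finset.mem_filter.2 ⟨hz, h⟩)
    · push Not at h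
      obtain ⟨j, hj⟩ := h
      exact Finset.mem_union_right _ (Finset.mem_biUnion.2
        ⟨j, Finset.mem_univ _, Finset.mem_filter.2 ⟨hz, hj⟩⟩)
  have h2 := (Finset.card_le_card h1).trans (Finset.card_union_le _ _)
  have h3 : (Finset.univ.biUnion fun j => T.filter fun z => ¬ good z (c j)).card ≤ m * K := by
    refine Finset.card_biUnion_le.trans ?_
    calc _ ≤ ∑ _j : Fin m, K := Finset.sum_le_sum fun j _ => hK _ (hc j)
      _ = m * K := by simp
  nlinarith

lemma nextSet_nonempty {K m : ℕ} (hT : T.Nonempty)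
    (hK : ∀ y ∈ T, (T.filter fun z => ¬ good z y).card ≤ K) (hm : 2 * m * K ≤ T.card)
    {c : Fin m → X} (hc : ∀ i, c i ∈ T) : (nextSet T good c).Nonempty := by
  have := card_le_two_mul_card_nextSet hK hm hc
  have h2 := hT.card_pos
  exact Finset.card_pos.1 (by omega)

lemma unifWt_nextSet_le {K m : ℕ} (hT : T.Nonempty)
    (hK : ∀ y ∈ T, (T.filter fun z => ¬ good z y).card ≤ K) (hm : 2 * m * K ≤ T.card)
    {c : Fin m → X} (hc : ∀ i, c i ∈ T) (z : X) :
    unifWt (nextSet T good c) z ≤ 2 * unifWt T z := by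
  have h1 : (T.card : ℝ) ≤ 2 * (nextSet T good c).card := by
    exact_mod_cast card_le_two_mul_card_nextSet hK hm hc
  have h2 : (0 : ℝ) < T.card := by exact_mod_cast hT.card_pos
  unfold unifWt
  by_cases hz : z ∈ nextSet T good c
  · rw [if_pos hz, if_pos (Finset.mem_filter.1 hz).1, ← div_eq_mul_inv, inv_eq_one_div,
      div_le_div_iff₀ (by linarith) h2]
    linarith
  · rw [if_neg hz]
    split_ifs <;> positivity

variable [Fintype X]

variable (T good)

/-- Expectation under the sequential construction. -/
def seqE (M : ℕ) (F : (Fin M → X) → ℝ) : ℝ := ∑ c, seqWt T good c * F c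

/-- Expectation for independent uniform points of `T`. -/
def iidE (M : ℕ) (F : (Fin M → X) → ℝ) : ℝ := ∑ c, (∏ i, unifWt T (c i)) * F c

lemma sum_unifWt_mul (S : Finset X) (f : X → ℝ) :
    ∑ z, unifWt S z * f z = (S.card : ℝ)⁻¹ * ∑ z ∈ S, f z := by
  simp [unifWt, ite_mul, Finset.sum_ite_mem, Finset.mul_sum]

lemma sum_unifWt {S : Finset X} (hS : S.Nonempty) : ∑ z, unifWt S z = 1 := by
  have := sum_unifWt_mul S (fun _ => 1)
  have h : (S.card : ℝ) ≠ 0 := by exact_mod_cast hS.card_pos.ne'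
  simpa [h] using this

lemma sum_snoc {m : ℕ} (f : (Fin (m + 1) → X) → ℝ) :
    ∑ c, f c = ∑ c : Fin m → X, ∑ z, f (Fin.snoc c z) := by
  rw [← (Fin.snocEquiv fun _ : Fin (m + 1) => X).sum_comp, Fintype.sum_prod_type,
    Finset.sum_comm]
  rfl

lemma seqE_succ {m : ℕ} (F : (Fin (m + 1) → X) → ℝ) :
    seqE T good (m + 1) F =
      seqE T good m fun c => ∑ z, unifWt (nextSet T good c) z * F (Fin.snoc c z) := by
  unfold seqE
  rw [sum_snoc]
  refine Finset.sum_congr rfl fun c _ => ?_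
  rw [Finset.mul_sum]
  refine Finset.sum_congr rfl fun z _ => ?_
  rw [seqWt_snoc, mul_assoc]

lemma iidE_succ {m : ℕ} (F : (Fin (m + 1) → X) → ℝ) :
    iidE T (m + 1) F = iidE T m fun c => ∑ z, unifWt T z * F (Fin.snoc c z) := by
  unfold iidE
  rw [sum_snoc]
  refine Finset.sum_congr rfl fun c _ => ?_
  rw [Finset.mul_sum]
  refine Finset.sum_congr rfl fun z _ => ?_
  rw [Fin.prod_univ_castSucc]
  simp [mul_assoc]

/-- Monotonicity of the expectation: it suffices to compare on codebooks with points in `T`. -/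
lemma seqE_mono {M : ℕ} {F G : (Fin M → X) → ℝ} (h : ∀ c, (∀ i, c i ∈ T) → F c ≤ G c) :
    seqE T good M F ≤ seqE T good M G := by
  refine Finset.sum_le_sum fun c _ => ?_
  by_cases hc : seqWt T good c = 0
  · simp [hc]
  · exact mul_le_mul_of_nonneg_left (h c (mem_of_seqWt_ne_zero T good hc)) (seqWt_nonneg _ _ _)

lemma seqE_congr {M : ℕ} {F G : (Fin M → X) → ℝ} (h : ∀ c, (∀ i, c i ∈ T) → F c = G c) :
    seqE T good M F = seqE T good M G :=
  le_antisymm (seqE_mono _ _ fun c hc => (h c hc).le) (seqE_mono _ _ fun c hc => (h c hc).ge)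

lemma seqE_nonneg {M : ℕ} {F : (Fin M → X) → ℝ} (h : ∀ c, 0 ≤ F c) : 0 ≤ seqE T good M F :=
  Finset.sum_nonneg fun c _ => mul_nonneg (seqWt_nonneg _ _ _) (h c)

lemma seqE_const_mul {M : ℕ} (a : ℝ) (F : (Fin M → X) → ℝ) :
    seqE T good M (fun c => a * F c) = a * seqE T good M F := by
  unfold seqE
  rw [Finset.mul_sum]
  exact Finset.sum_congr rfl fun c _ => by ring

lemma seqE_sub {M : ℕ} (F G : (Fin M → X) → ℝ) :
    seqE T good M (fun c => F c - G c) = seqE T good M F - seqE T good M G := by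
  unfold seqE
  rw [← Finset.sum_sub_distrib]
  exact Finset.sum_congr rfl fun c _ => by ring

lemma seqE_sum {M : ℕ} {ι : Type*} (s : Finset ι) (F : ι → (Fin M → X) → ℝ) :
    seqE T good M (fun c => ∑ e ∈ s, F e c) = ∑ e ∈ s, seqE T good M (F e) := by
  unfold seqE
  rw [Finset.sum_comm]
  exact Finset.sum_congr rfl fun c _ => by rw [Finset.mul_sum]

variable {T good}

/-- The sequential construction is dominated by independent uniform points, with a factor two for
each coordinate involved. -/
lemma seqE_le_two_pow_mul_iidE {K : ℕ} (hT : T.Nonempty)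
    (hK : ∀ y ∈ T, (T.filter fun z => ¬ good z y).card ≤ K) {M : ℕ} (hM : 2 * M * K ≤ T.card)
    (S : Finset (Fin M)) (F : (Fin M → X) → ℝ) (hF : ∀ c, 0 ≤ F c)
    (hS : ∀ c c', (∀ i ∈ S, c i = c' i) → F c = F c') :
    seqE T good M F ≤ 2 ^ S.card * iidE T M F := by
  induction M with
  | zero =>
    have : S = ∅ := Finset.eq_empty_of_isEmpty S
    subst this
    simp [seqE, iidE, seqWt]
  | succ m ih =>
    have hm : 2 * m * K ≤ T.card := le_trans (by gcongr; omega) hM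
    set S' : Finset (Fin m) := Finset.univ.filter fun i => i.castSucc ∈ S with hS'
    rw [seqE_succ, iidE_succ]
    have key := ih hm S' (fun c => ∑ z, unifWt T z * F (Fin.snoc c z))
      (fun c => Finset.sum_nonneg fun z _ => mul_nonneg (unifWt_nonneg _ _) (hF _)) (by
        intro c c' h
        refine Finset.sum_congr rfl fun z _ => ?_
        congr 1
        refine hS _ _ fun i hi => ?_
        induction i using Fin.lastCases with
        | last => simp
        | cast j => simpa using h j (by simpa [hS'] using hi))
    have hmap : S'.map Fin.castSuccEmb ⊆ S := by
      intro i hi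
      obtain ⟨j, hj, rfl⟩ := Finset.mem_map.1 hi
      simpa [hS'] using hj
    have hiid : 0 ≤ iidE T m fun c => ∑ z, unifWt T z * F (Fin.snoc c z) :=
      Finset.sum_nonneg fun c _ => mul_nonneg (Finset.prod_nonneg fun _ _ => unifWt_nonneg _ _)
        (Finset.sum_nonneg fun z _ => mul_nonneg (unifWt_nonneg _ _) (hF _))
    by_cases hl : Fin.last m ∈ S
    · have hcard : S'.card + 1 ≤ S.card := by
        have h1 : insert (Fin.last m) (S'.map Fin.castSuccEmb) ⊆ S :=
          Finset.insert_subset hl hmap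
        have h2 := Finset.card_le_card h1
        rwa [Finset.card_insert_of_notMem (by simp [Fin.castSucc_ne_last]), Finset.card_map] at h2
      calc seqE T good m (fun c => ∑ z, unifWt (nextSet T good c) z * F (Fin.snoc c z))
          ≤ seqE T good m (fun c => 2 * ∑ z, unifWt T z * F (Fin.snoc c z)) := by
            refine seqE_mono _ _ fun c hc => ?_
            rw [Finset.mul_sum]
            refine Finset.sum_le_sum fun z _ => ?_
            rw [← mul_assoc]
            exact mul_le_mul_of_nonneg_right (unifWt_nextSet_le hT hK hm hc z) (hF _)
        _ ≤ 2 * (2 ^ S'.card * iidE T m fun c => ∑ z, unifWt T z * F (Fin.snoc c z)) := by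
            rw [seqE_const_mul]
            gcongr
        _ = 2 ^ (S'.card + 1) * iidE T m fun c => ∑ z, unifWt T z * F (Fin.snoc c z) := by ring
        _ ≤ _ := by
            gcongr
            norm_num
    · have hcard : S'.card ≤ S.card := by simpa using Finset.card_le_card hmap
      calc seqE T good m (fun c => ∑ z, unifWt (nextSet T good c) z * F (Fin.snoc c z))
          = seqE T good m (fun c => ∑ z, unifWt T z * F (Fin.snoc c z)) := by
            refine seqE_congr _ _ fun c hc => ?_
            obtain ⟨z₀, -⟩ := id hT
            have h : ∀ z, F (Fin.snoc c z) = F (Fin.snoc c z₀) := by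
              intro z
              refine hS _ _ fun i hi => ?_
              induction i using Fin.lastCases with
              | last => exact absurd hi hl
              | cast j => simp
            simp_rw [h, ← Finset.sum_mul]
            rw [sum_unifWt hT, sum_unifWt (nextSet_nonempty hT hK hm hc)]
        _ ≤ 2 ^ S'.card * iidE T m fun c => ∑ z, unifWt T z * F (Fin.snoc c z) := key
        _ ≤ _ := by
            gcongr
            norm_num

lemma seqE_one {K : ℕ} (hT : T.Nonempty)
    (hK : ∀ y ∈ T, (T.filter fun z => ¬ good z y).card ≤ K) {M : ℕ} (hM : 2 * M * K ≤ T.card) :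
    seqE T good M (fun _ => 1) = 1 := by
  induction M with
  | zero => simp [seqE, seqWt]
  | succ m ih =>
    have hm : 2 * m * K ≤ T.card := le_trans (by gcongr; omega) hM
    rw [seqE_succ]
    refine Eq.trans ?_ (ih hm)
    refine seqE_congr _ _ fun c hc => ?_
    rw [← Finset.sum_mul, sum_unifWt (nextSet_nonempty hT hK hm hc), one_mul]

/-- Given the past, a feasible point is drawn with probability at least `1 / |T|`. -/
lemma seqE_mul_feasible_le {K : ℕ} (hT : T.Nonempty)
    (hK : ∀ y ∈ T, (T.filter fun z => ¬ good z y).card ≤ K) {M : ℕ} (hM : 2 * M * K ≤ T.card)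
    (i : Fin M) (F : (Fin M → X) → ℝ) (hF : ∀ c, 0 ≤ F c)
    (hi : ∀ c c', (∀ j < i, c j = c' j) → F c = F c') (y : X) :
    (T.card : ℝ)⁻¹ * seqE T good M (fun c => F c * if y ∈ feasSet T good c i then 1 else 0) ≤
      seqE T good M (fun c => F c * if c i = y then 1 else 0) := by
  induction M with
  | zero => exact i.elim0
  | succ m ih =>
    have hm : 2 * m * K ≤ T.card := le_trans (by gcongr; omega) hM
    obtain ⟨z₀, hz₀⟩ := id hT
    rw [seqE_succ, seqE_succ]
    induction i using Fin.lastCases with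
    | last =>
      have h : ∀ c : Fin m → X, ∀ z, F (Fin.snoc c z) = F (Fin.snoc c z₀) := by
        intro c z
        refine hi _ _ fun i hi => ?_
        induction i using Fin.lastCases with
        | last => exact absurd hi (lt_irrefl _)
        | cast j => simp
      rw [← seqE_const_mul]
      refine seqE_mono _ _ fun c hc => ?_
      have hne := nextSet_nonempty hT hK hm hc
      simp only [feasSet_snoc_last, h, Fin.snoc_last]
      rw [← Finset.sum_mul, sum_unifWt hne]
      have h2 : ∑ z, unifWt (nextSet T good c) z *
          (F (Fin.snoc c z₀) * if z = y then 1 else 0) =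
          unifWt (nextSet T good c) y * F (Fin.snoc c z₀) := by
        simp [mul_ite]
      rw [h2]
      unfold unifWt
      split_ifs with hy
      · rw [one_mul, mul_one]
        refine mul_le_mul_of_nonneg_right ?_ (hF _)
        refine inv_anti₀ (by exact_mod_cast hne.card_pos) ?_
        exact_mod_cast Finset.card_le_card (Finset.filter_subset _ _)
      · simp
    | cast i =>
      have h : ∀ c : Fin m → X, ∀ z, F (Fin.snoc c z) = F (Fin.snoc c z₀) := by
        intro c z
        refine hi _ _ fun j hj => ?_
        induction j using Fin.lastCases with
        | last => exact absurd hj (by simp [Fin.le_last])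
        | cast j => simp
      have key := ih hm i (fun c => F (Fin.snoc c z₀)) (fun c => hF _) (by
        intro c c' hcc
        refine hi _ _ fun j hj => ?_
        induction j using Fin.lastCases with
        | last => simp
        | cast j => simpa using hcc j (by simpa using hj))
      have e1 : ∀ G : (Fin m → X) → ℝ, seqE T good m
          (fun c => ∑ z, unifWt (nextSet T good c) z * G c) = seqE T good m G := by
        intro G
        refine seqE_congr _ _ fun c hc => ?_
        rw [← Finset.sum_mul, sum_unifWt (nextSet_nonempty hT hK hm hc), one_mul]
      simp only [feasSet_snoc_castSucc, h, Fin.snoc_castSucc]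
      rw [e1, e1]
      exact key

end Sequential
end RGV

namespace RGV

section Moments

variable {X : Type} {T : Finset X}

/-- Indicator that the ordered pair `e` consists of distinct indices whose points are related. -/
def edgeInd (A : X → X → Prop) {M : ℕ} (e : Fin M × Fin M) (c : Fin M → X) : ℝ :=
  if e.1 ≠ e.2 ∧ A (c e.1) (c e.2) then 1 else 0

/-- Number of ordered pairs of distinct indices whose points are related. -/
def edgeCount (A : X → X → Prop) {M : ℕ} (c : Fin M → X) : ℝ := ∑ e, edgeInd A e c

lemma edgeInd_nonneg (A : X → X → Prop) {M : ℕ} (e : Fin M × Fin M) (c : Fin M → X) :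
    0 ≤ edgeInd A e c := by
  unfold edgeInd; split_ifs <;> norm_num

variable [Fintype X]

lemma iidE_mono {M : ℕ} {F G : (Fin M → X) → ℝ} (h : ∀ c, (∀ i, c i ∈ T) → F c ≤ G c) :
    iidE T M F ≤ iidE T M G := by
  refine Finset.sum_le_sum fun c _ => ?_
  by_cases hc : ∀ i, c i ∈ T
  · exact mul_le_mul_of_nonneg_left (h c hc) (Finset.prod_nonneg fun _ _ => unifWt_nonneg _ _)
  · push Not at hc
    obtain ⟨i, hi⟩ := hc
    have : ∏ i, unifWt T (c i) = 0 :=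
      Finset.prod_eq_zero (Finset.mem_univ i) (by simp [unifWt, hi])
    simp [this]

lemma iidE_nonneg {M : ℕ} {F : (Fin M → X) → ℝ} (h : ∀ c, 0 ≤ F c) : 0 ≤ iidE T M F :=
  Finset.sum_nonneg fun c _ =>
    mul_nonneg (Finset.prod_nonneg fun _ _ => unifWt_nonneg _ _) (h c)

lemma iidE_const_mul {M : ℕ} (a : ℝ) (F : (Fin M → X) → ℝ) :
    iidE T M (fun c => a * F c) = a * iidE T M F := by
  unfold iidE
  rw [Finset.mul_sum]
  exact Finset.sum_congr rfl fun c _ => by ring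

lemma iidE_one (hT : T.Nonempty) (M : ℕ) : iidE T M (fun _ => 1) = 1 := by
  induction M with
  | zero => simp [iidE]
  | succ m ih =>
    rw [iidE_succ]
    simpa [sum_unifWt hT] using ih

/-- Resampling one coordinate of independent uniform points does not change expectations. -/
lemma iidE_resample (hT : T.Nonempty) {M : ℕ} (m : Fin M) (H : (Fin M → X) → ℝ) :
    iidE T M H = iidE T M fun c => ∑ z, unifWt T z * H (Function.update c m z) := by
  have hinv : Function.Involutive
      (fun q : (Fin M → X) × X => (Function.update q.1 m q.2, q.1 m)) := by
    intro q
    simp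
  have hw : ∀ c : Fin M → X, ∀ z, (∏ i, unifWt T (Function.update c m z i)) * unifWt T (c m) =
      (∏ i, unifWt T (c i)) * unifWt T z := by
    intro c z
    rw [← Finset.mul_prod_erase _ _ (Finset.mem_univ m),
      ← Finset.mul_prod_erase _ (fun i => unifWt T (c i)) (Finset.mem_univ m)]
    have : ∏ i ∈ Finset.univ.erase m, unifWt T (Function.update c m z i) =
        ∏ i ∈ Finset.univ.erase m, unifWt T (c i) :=
      Finset.prod_congr rfl fun i hi => by
        rw [Function.update_of_ne (Finset.ne_of_mem_erase hi)]
    rw [this, Function.update_self]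
    ring
  have h1 : iidE T M H = ∑ q : (Fin M → X) × X,
      ((∏ i, unifWt T (q.1 i)) * unifWt T q.2) * H q.1 := by
    rw [Fintype.sum_prod_type]
    refine Finset.sum_congr rfl fun c _ => ?_
    simp only
    rw [← Finset.sum_mul, ← Finset.mul_sum, sum_unifWt hT, mul_one]
  rw [h1, ← Equiv.sum_comp hinv.toPerm, Fintype.sum_prod_type]
  refine Finset.sum_congr rfl fun c _ => ?_
  rw [Finset.mul_sum]
  refine Finset.sum_congr rfl fun z _ => ?_
  simp only [Function.Involutive.coe_toPerm]
  rw [hw, mul_assoc]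

variable {A : X → X → Prop} {p : ℝ}

/-- An edge with an endpoint not involved in `F` costs a factor `p`. -/
lemma iidE_mul_edgeInd_le (hT : T.Nonempty) (hp : 0 ≤ p)
    (hp1 : ∀ y ∈ T, ((T.filter fun x => A x y).card : ℝ) ≤ p * T.card)
    (hp2 : ∀ x ∈ T, ((T.filter fun y => A x y).card : ℝ) ≤ p * T.card) {M : ℕ}
    {V : Finset (Fin M)} {F : (Fin M → X) → ℝ} (hF : ∀ c, 0 ≤ F c)
    (hV : ∀ c c', (∀ i ∈ V, c i = c' i) → F c = F c') {e : Fin M × Fin M}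
    (he : e.1 ∉ V ∨ e.2 ∉ V) :
    iidE T M (fun c => F c * edgeInd A e c) ≤ p * iidE T M F := by
  have hcard : (0 : ℝ) < T.card := by exact_mod_cast hT.card_pos
  have hupd : ∀ m ∉ V, ∀ c z, F (Function.update c m z) = F c := by
    intro m hm c z
    refine hV _ _ fun i hi => ?_
    rw [Function.update_of_ne]
    rintro rfl
    exact hm hi
  have hsum : ∀ B : X → Prop, ((T.filter B).card : ℝ) ≤ p * T.card → ∀ c,
      ∑ z, unifWt T z * (F c * if B z then 1 else 0) ≤ p * F c := by
    intro B hB c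
    rw [sum_unifWt_mul, ← Finset.mul_sum, Finset.sum_boole, ← mul_assoc, mul_comm _ (F c),
      mul_assoc, mul_comm p]
    refine mul_le_mul_of_nonneg_left ?_ (hF c)
    rw [inv_mul_le_iff₀ hcard]
    linarith
  by_cases hne : e.1 = e.2
  · have : iidE T M (fun c => F c * edgeInd A e c) = 0 := by simp [edgeInd, hne, iidE]
    rw [this]
    exact mul_nonneg hp (iidE_nonneg hF)
  rw [← iidE_const_mul]
  rcases he with he | he
  · rw [iidE_resample hT e.1]
    refine iidE_mono fun c hc => ?_
    simp only [edgeInd, hupd _ he, Function.update_self, Function.update_of_ne (Ne.symm hne)]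
    simpa [hne] using hsum (fun z => A z (c e.2)) (hp1 _ (hc _)) c
  · rw [iidE_resample hT e.2]
    refine iidE_mono fun c hc => ?_
    simp only [edgeInd, hupd _ he, Function.update_self, Function.update_of_ne hne]
    simpa [hne] using hsum (fun z => A (c e.1) z) (hp2 _ (hc _)) c

lemma sum_iidE_mul_edgeInd_le (hT : T.Nonempty) (hp : 0 ≤ p)
    (hp1 : ∀ y ∈ T, ((T.filter fun x => A x y).card : ℝ) ≤ p * T.card)
    (hp2 : ∀ x ∈ T, ((T.filter fun y => A x y).card : ℝ) ≤ p * T.card) {M : ℕ}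
    {V : Finset (Fin M)} {F : (Fin M → X) → ℝ} (hF : ∀ c, 0 ≤ F c)
    (hV : ∀ c c', (∀ i ∈ V, c i = c' i) → F c = F c') :
    ∑ e, iidE T M (fun c => F c * edgeInd A e c) ≤
      ((M : ℝ) ^ 2 * p + (V.card : ℝ) ^ 2) * iidE T M F := by
  have hI : 0 ≤ iidE T M F := iidE_nonneg hF
  have hbound : ∀ e : Fin M × Fin M, iidE T M (fun c => F c * edgeInd A e c) ≤
      p * iidE T M F + if e ∈ V ×ˢ V then iidE T M F else 0 := by
    intro e
    split_ifs with he
    · have : iidE T M (fun c => F c * edgeInd A e c) ≤ iidE T M F := by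
        refine iidE_mono fun c _ => mul_le_of_le_one_right (hF c) ?_
        unfold edgeInd; split_ifs <;> norm_num
      have := mul_nonneg hp hI
      linarith
    · rw [add_zero]
      refine iidE_mul_edgeInd_le hT hp hp1 hp2 hF hV ?_
      rw [Finset.mem_product] at he
      tauto
  refine (Finset.sum_le_sum fun e _ => hbound e).trans (le_of_eq ?_)
  rw [Finset.sum_add_distrib, Finset.sum_ite_mem]
  simp
  ring

variable {good : X → X → Prop} {K : ℕ}

/-- Moments of the edge count of the sequential construction. -/
lemma seqE_mul_edgeCount_pow_le (hT : T.Nonempty)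
    (hK : ∀ y ∈ T, (T.filter fun z => ¬ good z y).card ≤ K) {M : ℕ} (hM : 2 * M * K ≤ T.card)
    (hp : 0 ≤ p)
    (hp1 : ∀ y ∈ T, ((T.filter fun x => A x y).card : ℝ) ≤ p * T.card)
    (hp2 : ∀ x ∈ T, ((T.filter fun y => A x y).card : ℝ) ≤ p * T.card)
    (k v : ℕ) {V : Finset (Fin M)} (hv : V.card ≤ v) {F : (Fin M → X) → ℝ} (hF : ∀ c, 0 ≤ F c)
    (hV : ∀ c c', (∀ i ∈ V, c i = c' i) → F c = F c') :
    seqE T good M (fun c => F c * edgeCount A c ^ k) ≤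
      2 ^ (v + 2 * k) * (∏ j ∈ Finset.range k, ((M : ℝ) ^ 2 * p + ((v : ℝ) + 2 * j) ^ 2)) *
        iidE T M F := by
  induction k generalizing v V F with
  | zero =>
    simp only [pow_zero, mul_one, mul_zero, add_zero, Finset.range_zero, Finset.prod_empty]
    refine (seqE_le_two_pow_mul_iidE hT hK hM V F hF hV).trans ?_
    have := iidE_nonneg (T := T) hF
    gcongr
    norm_num
  | succ k ih =>
    have h1 : seqE T good M (fun c => F c * edgeCount A c ^ (k + 1)) =
        ∑ e, seqE T good M (fun c => (F c * edgeInd A e c) * edgeCount A c ^ k) := by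
      rw [← seqE_sum]
      congr 1
      funext c
      rw [← Finset.sum_mul, ← Finset.mul_sum, pow_succ']
      unfold edgeCount
      ring
    have h2 : ∀ e : Fin M × Fin M,
        seqE T good M (fun c => (F c * edgeInd A e c) * edgeCount A c ^ k) ≤
        2 ^ (v + 2 + 2 * k) *
          (∏ j ∈ Finset.range k, ((M : ℝ) ^ 2 * p + (((v + 2 : ℕ) : ℝ) + 2 * j) ^ 2)) *
          iidE T M (fun c => F c * edgeInd A e c) := by
      intro e
      refine ih (v + 2) (V := insert e.1 (insert e.2 V)) ?_
        (fun c => mul_nonneg (hF c) (edgeInd_nonneg A e c)) ?_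
      · have a1 := Finset.card_insert_le e.1 (insert e.2 V)
        have a2 := Finset.card_insert_le e.2 V
        omega
      · intro c c' h
        have b1 : F c = F c' := hV _ _ fun i hi => h i (by simp [hi])
        have b2 : c e.1 = c' e.1 := h _ (by simp)
        have b3 : c e.2 = c' e.2 := h _ (by simp)
        simp only [edgeInd, b1, b2, b3]
    rw [h1]
    refine (Finset.sum_le_sum fun e _ => h2 e).trans ?_
    rw [← Finset.mul_sum]
    have h3 := sum_iidE_mul_edgeInd_le hT hp hp1 hp2 hF hV
    have h4 : ((M : ℝ) ^ 2 * p + (V.card : ℝ) ^ 2) * iidE T M F ≤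
        ((M : ℝ) ^ 2 * p + (v : ℝ) ^ 2) * iidE T M F := by
      have := iidE_nonneg (T := T) hF
      gcongr
    have h5 : (0 : ℝ) ≤ 2 ^ (v + 2 + 2 * k) *
        (∏ j ∈ Finset.range k, ((M : ℝ) ^ 2 * p + (((v + 2 : ℕ) : ℝ) + 2 * j) ^ 2)) :=
      mul_nonneg (by positivity) (Finset.prod_nonneg fun j _ => by positivity)
    refine (mul_le_mul_of_nonneg_left (h3.trans h4) h5).trans (le_of_eq ?_)
    rw [Finset.prod_range_succ']
    have h6 : ∀ j : ℕ, ((v + 2 : ℕ) : ℝ) + 2 * j = v + 2 * ((j + 1 : ℕ) : ℝ) := by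
      intro j; push_cast; ring
    simp only [h6]
    push_cast
    ring

lemma seqE_edgeCount_pow_le (hT : T.Nonempty)
    (hK : ∀ y ∈ T, (T.filter fun z => ¬ good z y).card ≤ K) {M : ℕ} (hM : 2 * M * K ≤ T.card)
    (hp : 0 ≤ p)
    (hp1 : ∀ y ∈ T, ((T.filter fun x => A x y).card : ℝ) ≤ p * T.card)
    (hp2 : ∀ x ∈ T, ((T.filter fun y => A x y).card : ℝ) ≤ p * T.card) (k : ℕ) :
    seqE T good M (fun c => edgeCount A c ^ k) ≤
      4 ^ k * ∏ j ∈ Finset.range k, ((M : ℝ) ^ 2 * p + (2 * j) ^ 2) := by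
  have := seqE_mul_edgeCount_pow_le (M := M) hT hK hM hp hp1 hp2 k 0 (V := ∅) (by simp)
    (F := fun _ => 1) (fun _ => zero_le_one) (fun _ _ _ => rfl)
  rw [iidE_one hT] at this
  simpa [pow_mul, show (2 : ℝ) ^ 2 = 4 by norm_num] using this

/-- Lower bound on the probability that two given positions carry two given compatible points. -/
lemma le_seqE_pair (hT : T.Nonempty)
    (hK : ∀ y ∈ T, (T.filter fun z => ¬ good z y).card ≤ K) {M : ℕ} (hM : 12 * M * K ≤ T.card)
    (hK' : ∀ y ∈ T, (T.filter fun z => ¬ good y z).card ≤ K)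
    {i j : Fin M} (hij : i < j) {x y : X} (hx : x ∈ T) (hy : y ∈ T) (hg : good y x) :
    (2 * (T.card : ℝ) ^ 2)⁻¹ ≤
      seqE T good M (fun c => (if c i = x then 1 else 0) * if c j = y then 1 else 0) := by
  have hcard : (0 : ℝ) < T.card := by exact_mod_cast hT.card_pos
  have hM2 : 2 * M * K ≤ T.card := le_trans (by gcongr; norm_num) hM
  have hMr : 12 * (M : ℝ) * K ≤ T.card := by exact_mod_cast hM
  -- probability that a given point conflicts with a given position
  have hconf : ∀ w ∈ T, ∀ l : Fin M,
      iidE T M (fun c => if ¬ good w (c l) then 1 else 0) ≤ K / T.card := by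
    intro w hw l
    rw [iidE_resample hT l]
    calc _ ≤ iidE T M (fun _ => K / T.card * 1) := by
          refine iidE_mono fun c _ => ?_
          simp only [Function.update_self]
          rw [sum_unifWt_mul, Finset.sum_boole, mul_one, inv_mul_eq_div]
          gcongr
          exact_mod_cast hK' w hw
      _ = _ := by rw [iidE_const_mul, iidE_one hT, mul_one]
  have hconf2 : ∀ l : Fin M, l ≠ i →
      iidE T M (fun c => (if c i = x then 1 else 0) * if ¬ good y (c l) then 1 else 0) ≤
      (T.card : ℝ)⁻¹ * (K / T.card) := by
    intro l hl
    rw [iidE_resample hT i]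
    calc _ ≤ iidE T M (fun c => (T.card : ℝ)⁻¹ * if ¬ good y (c l) then 1 else 0) := by
          refine iidE_mono fun c _ => ?_
          simp only [Function.update_self, Function.update_of_ne hl]
          simp [unifWt, hx]
      _ ≤ _ := by
          rw [iidE_const_mul]
          exact mul_le_mul_of_nonneg_left (hconf y hy l) (by positivity)
  -- the first position
  have hfirst : (T.card : ℝ)⁻¹ * (1 - 2 * M * K / T.card) ≤
      seqE T good M (fun c => if c i = x then 1 else 0) := by
    have h1 := seqE_mul_feasible_le hT hK hM2 i (fun _ => 1) (fun _ => zero_le_one)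
      (fun _ _ _ => rfl) x
    simp only [one_mul] at h1
    refine le_trans (mul_le_mul_of_nonneg_left ?_ (by positivity)) h1
    have h2 : seqE T good M (fun c => 1 - ∑ l : Fin M, if ¬ good x (c l) then (1 : ℝ) else 0) ≤
        seqE T good M (fun c => if x ∈ feasSet T good c i then 1 else 0) := by
      refine seqE_mono _ _ fun c _ => ?_
      have hnn : ∀ l ∈ (Finset.univ : Finset (Fin M)),
          (0 : ℝ) ≤ if ¬ good x (c l) then (1 : ℝ) else 0 := by
        intro l _; split_ifs <;> norm_num
      split_ifs with hf
      · linarith [Finset.sum_nonneg hnn]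
      · have : ∃ l, ¬ good x (c l) := by
          by_contra! hcon
          exact hf (Finset.mem_filter.2 ⟨hx, fun l _ => hcon l⟩)
        obtain ⟨l, hl⟩ := this
        have := Finset.single_le_sum hnn (Finset.mem_univ l)
        rw [if_pos hl] at this
        linarith
    refine le_trans ?_ h2
    rw [seqE_sub, seqE_one hT hK hM2, seqE_sum]
    have h3 : ∀ l : Fin M, seqE T good M (fun c => if ¬ good x (c l) then (1 : ℝ) else 0) ≤
        2 * (K / T.card) := by
      intro l
      refine (seqE_le_two_pow_mul_iidE hT hK hM2 {l} _ ?_ ?_).trans ?_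
      · intro c; split_ifs <;> norm_num
      · intro c c' h
        rw [h l (by simp)]
      · rw [Finset.card_singleton, pow_one]
        exact mul_le_mul_of_nonneg_left (hconf x hx l) (by norm_num)
    have h4 := Finset.sum_le_sum fun l (_ : l ∈ (Finset.univ : Finset (Fin M))) => h3 l
    rw [Finset.sum_const, Finset.card_univ, Fintype.card_fin, nsmul_eq_mul] at h4
    have h5 : (M : ℝ) * (2 * (K / T.card)) = 2 * M * K / T.card := by ring
    linarith
  -- the second position
  have h1 := seqE_mul_feasible_le hT hK hM2 j (fun c => if c i = x then 1 else 0)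
    (fun c => by split_ifs <;> norm_num) (fun c c' h => by rw [h i hij]) y
  refine le_trans ?_ h1
  have h2 : seqE T good M (fun c => (if c i = x then 1 else 0) -
        ∑ l ∈ Finset.univ.erase i, (if c i = x then 1 else 0) *
          if ¬ good y (c l) then (1 : ℝ) else 0) ≤
      seqE T good M (fun c => (if c i = x then 1 else 0) *
        if y ∈ feasSet T good c j then 1 else 0) := by
    refine seqE_mono _ _ fun c _ => ?_
    by_cases hci : c i = x
    · have hnn : ∀ l ∈ Finset.univ.erase i,
          (0 : ℝ) ≤ if ¬ good y (c l) then (1 : ℝ) else 0 := by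
        intro l _; split_ifs <;> norm_num
      simp only [hci, if_true, one_mul]
      by_cases hf : y ∈ feasSet T good c j
      · rw [if_pos hf]
        linarith [Finset.sum_nonneg hnn]
      · rw [if_neg hf]
        have : ∃ l, l ≠ i ∧ ¬ good y (c l) := by
          by_contra! hcon
          refine hf (Finset.mem_filter.2 ⟨hy, fun l _ => ?_⟩)
          by_cases hl : l = i
          · rw [hl, hci]; exact hg
          · exact hcon l hl
        obtain ⟨l, hl, hl2⟩ := this
        have := Finset.single_le_sum hnn (Finset.mem_erase.2 ⟨hl, Finset.mem_univ l⟩)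
        rw [if_pos hl2] at this
        linarith
    · simp [hci]
  have h3 : ∀ l ∈ Finset.univ.erase i, seqE T good M (fun c => (if c i = x then 1 else 0) *
          if ¬ good y (c l) then (1 : ℝ) else 0) ≤ 4 * ((T.card : ℝ)⁻¹ * (K / T.card)) := by
    intro l hl
    have hl' : l ≠ i := Finset.ne_of_mem_erase hl
    refine (seqE_le_two_pow_mul_iidE hT hK hM2 {i, l} _ ?_ ?_).trans ?_
    · intro c; split_ifs <;> norm_num
    · intro c c' h
      rw [h i (by simp), h l (by simp)]
    · rw [Finset.card_pair hl'.symm, show (2 : ℝ) ^ 2 = 4 by norm_num]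
      exact mul_le_mul_of_nonneg_left (hconf2 l hl') (by norm_num)
  rw [seqE_sub, seqE_sum] at h2
  have h4 := Finset.sum_le_sum h3
  rw [Finset.sum_const, nsmul_eq_mul] at h4
  have h5 : ((Finset.univ.erase i).card : ℝ) * (4 * ((T.card : ℝ)⁻¹ * (K / T.card))) ≤
      M * (4 * ((T.card : ℝ)⁻¹ * (K / T.card))) := by
    gcongr
    simp
  have h6 : (T.card : ℝ)⁻¹ * (1 - 6 * (M * K / T.card)) ≤
      seqE T good M (fun c => (if c i = x then 1 else 0) *
        if y ∈ feasSet T good c j then 1 else 0) := by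
    have e1 : (M : ℝ) * (4 * ((T.card : ℝ)⁻¹ * (K / T.card))) =
        (T.card : ℝ)⁻¹ * (4 * (M * K / T.card)) := by ring
    have e2 : (T.card : ℝ)⁻¹ * (1 - 2 * M * K / T.card) =
        (T.card : ℝ)⁻¹ * (1 - 6 * (M * K / T.card)) + (T.card : ℝ)⁻¹ * (4 * (M * K / T.card)) := by
      ring
    linarith
  have h7 : (M : ℝ) * K / T.card ≤ 1 / 12 := by
    rw [div_le_iff₀ hcard]
    linarith
  have e3 : (2 * (T.card : ℝ) ^ 2)⁻¹ = (T.card : ℝ)⁻¹ * ((T.card : ℝ)⁻¹ * (1 / 2)) := by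
    field_simp
  rw [e3]
  refine mul_le_mul_of_nonneg_left (le_trans (mul_le_mul_of_nonneg_left ?_ ?_) h6) ?_
  · linarith
  · positivity
  · positivity

lemma card_lt_pairs (M : ℕ) :
    2 * ((Finset.univ : Finset (Fin M × Fin M)).filter fun e => e.1 < e.2).card = M * (M - 1) := by
  have h : ((Finset.univ : Finset (Fin M × Fin M)).filter fun e => e.1 < e.2).card =
      ∑ j : Fin M, (j : ℕ) := by
    rw [Finset.card_filter, Fintype.sum_prod_type, Finset.sum_comm]
    refine Finset.sum_congr rfl fun j _ => ?_
    rw [← Finset.card_filter, ← Fin.card_Iio j]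
    congr 1
    ext i
    simp
  rw [h, Fin.sum_univ_eq_sum_range (fun i => i), mul_comm, Finset.sum_range_id_mul_two]

/-- Lower bound on the expected edge count. -/
lemma le_seqE_edgeCount (hT : T.Nonempty)
    (hK : ∀ y ∈ T, (T.filter fun z => ¬ good z y).card ≤ K) {M : ℕ} (hM : 12 * M * K ≤ T.card)
    (hK' : ∀ y ∈ T, (T.filter fun z => ¬ good y z).card ≤ K) (hM2 : 2 ≤ M)
    (hA : ∀ x y, A x y → good y x) :
    (M : ℝ) ^ 2 * ((T ×ˢ T).filter fun q => A q.1 q.2).card / (8 * (T.card : ℝ) ^ 2) ≤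
      seqE T good M (edgeCount A) := by
  set S := (T ×ˢ T).filter fun q => A q.1 q.2 with hS
  set E := (Finset.univ : Finset (Fin M × Fin M)).filter fun e => e.1 < e.2 with hE
  have h1 : seqE T good M (fun c => ∑ e ∈ E, ∑ q ∈ S,
      (if c e.1 = q.1 then 1 else 0) * if c e.2 = q.2 then 1 else 0) ≤
      seqE T good M (edgeCount A) := by
    refine seqE_mono _ _ fun c hc => ?_
    unfold edgeCount
    refine le_trans (Finset.sum_le_sum (g := fun e => edgeInd A e c) fun e he => ?_)
      (Finset.sum_le_sum_of_subset_of_nonneg (Finset.filter_subset _ _)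
        fun e _ _ => edgeInd_nonneg A e c)
    have hlt : e.1 < e.2 := (Finset.mem_filter.1 he).2
    have h2 : ∀ q : X × X, ((if c e.1 = q.1 then 1 else 0) * if c e.2 = q.2 then 1 else 0 : ℝ) =
        if (c e.1, c e.2) = q then 1 else 0 := by
      intro q
      simp only [Prod.ext_iff]
      split_ifs <;> simp_all
    simp only [h2, Finset.sum_ite_eq]
    unfold edgeInd
    split_ifs with h3 h4 h4
    · exact le_rfl
    · exact absurd ⟨hlt.ne, (Finset.mem_filter.1 h3).2⟩ h4
    · exact zero_le_one
    · exact le_rfl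
  refine le_trans ?_ h1
  rw [seqE_sum]
  have h2 : ∀ e ∈ E, (S.card : ℝ) * (2 * (T.card : ℝ) ^ 2)⁻¹ ≤
      seqE T good M (fun c => ∑ q ∈ S,
        (if c e.1 = q.1 then 1 else 0) * if c e.2 = q.2 then 1 else 0) := by
    intro e he
    rw [seqE_sum, ← nsmul_eq_mul, ← Finset.sum_const]
    refine Finset.sum_le_sum fun q hq => ?_
    obtain ⟨hq1, hq2⟩ := Finset.mem_filter.1 hq
    rw [Finset.mem_product] at hq1
    exact le_seqE_pair hT hK hM hK' (Finset.mem_filter.1 he).2 hq1.1 hq1.2 (hA _ _ hq2)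
  refine le_trans ?_ (Finset.sum_le_sum h2)
  rw [Finset.sum_const, nsmul_eq_mul]
  have hEc : (M : ℝ) ^ 2 / 4 ≤ E.card := by
    have h3 := card_lt_pairs M
    rw [← hE] at h3
    have h4 : 2 * (E.card : ℝ) = M * (M - 1) := by
      have := congrArg (Nat.cast (R := ℝ)) h3
      push_cast [Nat.cast_sub (show 1 ≤ M by omega)] at this
      exact this
    have h5 : (2 : ℝ) ≤ M := by exact_mod_cast hM2
    nlinarith
  calc _ = (M : ℝ) ^ 2 / 4 * (S.card * (2 * (T.card : ℝ) ^ 2)⁻¹) := by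
        rw [mul_inv]; ring
    _ ≤ _ := by gcongr

/-- Markov's inequality for a power. -/
lemma pow_mul_seqE_le {M : ℕ} {Y : (Fin M → X) → ℝ} (hY : ∀ c, 0 ≤ Y c) {a : ℝ} (ha : 0 ≤ a)
    (k : ℕ) :
    a ^ k * seqE T good M (fun c => if a ≤ Y c then 1 else 0) ≤
      seqE T good M (fun c => Y c ^ k) := by
  rw [← seqE_const_mul]
  refine seqE_mono _ _ fun c _ => ?_
  have := pow_nonneg (hY c) k
  split_ifs with h
  · rw [mul_one]; gcongr
  · simpa using this

/-- The Paley–Zygmund inequality at half the mean. -/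
lemma sq_seqE_le_mul {M : ℕ} (h1 : seqE T good M (fun _ => 1) = 1) (Y : (Fin M → X) → ℝ)
    (h0 : 0 ≤ seqE T good M Y) : (seqE T good M Y / 2) ^ 2 ≤
      seqE T good M (fun c => if seqE T good M Y / 2 ≤ Y c then 1 else 0) *
        seqE T good M (fun c => Y c ^ 2) := by
  set μ := seqE T good M Y with hμ
  have h2 : μ / 2 ≤ seqE T good M (fun c => if μ / 2 ≤ Y c then Y c else 0) := by
    have h3 : seqE T good M (fun c => Y c - μ / 2 * 1) ≤
        seqE T good M (fun c => if μ / 2 ≤ Y c then Y c else 0) := by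
      refine seqE_mono _ _ fun c _ => ?_
      split_ifs with h <;> linarith
    rw [seqE_sub, seqE_const_mul, h1, ← hμ] at h3
    linarith
  have h3 : seqE T good M (fun c => if μ / 2 ≤ Y c then Y c else 0) ^ 2 ≤
      seqE T good M (fun c => if μ / 2 ≤ Y c then 1 else 0) *
        seqE T good M (fun c => Y c ^ 2) := by
    unfold seqE
    beta_reduce
    refine Finset.sum_sq_le_sum_mul_sum_of_sq_le_mul _ (fun c _ => ?_) (fun c _ => ?_)
      (fun c _ => ?_)
    · have := seqWt_nonneg T good c
      split_ifs <;> simp [this]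
    · exact mul_nonneg (seqWt_nonneg T good c) (sq_nonneg _)
    · split_ifs
      · exact le_of_eq (by ring)
      · simp
  refine le_trans ?_ h3
  gcongr

end Moments
end RGV

namespace RGV

section Types

variable {β : Type} [Fintype β] {n : ℕ}

/-- Number of occurrences of each letter. -/
def cnt (x : Fin n → β) (b : β) : ℕ := (Finset.univ.filter fun i => x i = b).card

/-- Entropy (natural logarithms). -/
def ent (Q : β → ℝ) : ℝ := -∑ b, Q b * Real.log (Q b)

lemma sum_cnt (x : Fin n → β) : ∑ b, cnt x b = n := by
  have h := Finset.card_eq_sum_card_fiberwise (f := x) (s := Finset.univ) (t := Finset.univ)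
    fun _ _ => Finset.mem_coe.2 (Finset.mem_univ _)
  rw [Finset.card_univ, Fintype.card_fin] at h
  exact h.symm

lemma cnt_le {γ : Type} (x : Fin n → γ) (b : γ) : cnt x b ≤ n := by
  have h := Finset.card_le_univ (Finset.univ.filter fun i => x i = b)
  rwa [Fintype.card_fin] at h

lemma sum_comp_cnt (x : Fin n → β) (f : β → ℝ) : ∑ i, f (x i) = ∑ b, cnt x b * f b := by
  rw [← Finset.sum_fiberwise Finset.univ x]
  refine Finset.sum_congr rfl fun b _ => ?_
  rw [Finset.sum_congr rfl fun i hi => by rw [(Finset.mem_filter.1 hi).2], Finset.sum_const,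
    nsmul_eq_mul]
  rfl

lemma prod_comp_cnt (x : Fin n → β) (f : β → ℕ) : ∏ i, f (x i) = ∏ b, f b ^ cnt x b := by
  rw [← Finset.prod_fiberwise Finset.univ x]
  refine Finset.prod_congr rfl fun b _ => ?_
  rw [Finset.prod_congr rfl fun i hi => by rw [(Finset.mem_filter.1 hi).2], Finset.prod_const]
  rfl

lemma exists_cnt_eq (k : β → ℕ) (hk : ∑ b, k b = n) : ∃ x : Fin n → β, cnt x = k := by
  have e : Fin n ≃ Σ b, Fin (k b) := Fintype.equivOfCardEq (by simp [hk])
  refine ⟨fun i => (e i).1, funext fun b => ?_⟩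
  have h : (Finset.univ : Finset (Fin (k b))).card = cnt (fun i => (e i).1) b := by
    refine Finset.card_bij (fun j _ => e.symm ⟨b, j⟩) (by simp) (by simp) ?_
    intro i hi
    have hi : (e i).1 = b := (Finset.mem_filter.1 hi).2
    subst hi
    exact ⟨(e i).2, Finset.mem_univ _, by simp⟩
  rw [← h, Finset.card_univ, Fintype.card_fin]

/-- The size of a type class is a multinomial coefficient. -/
lemma card_cnt_eq_mul_prod_factorial (x₀ : Fin n → β) :
    (Finset.univ.filter fun x : Fin n → β => cnt x = cnt x₀).card * ∏ b, (cnt x₀ b).factorial =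
      n.factorial := by
  have hstab : (Finset.univ.filter fun σ : Equiv.Perm (Fin n) => x₀ ∘ σ = x₀).card =
      ∏ b, (cnt x₀ b).factorial := by
    rw [← Fintype.card_subtype, DomMulAct.stabilizer_card]
    simp only [cnt, Fintype.card_subtype]
  have hmaps : ∀ σ ∈ (Finset.univ : Finset (Equiv.Perm (Fin n))),
      x₀ ∘ σ ∈ Finset.univ.filter fun x : Fin n → β => cnt x = cnt x₀ := by
    intro σ _
    rw [Finset.mem_filter]
    refine ⟨Finset.mem_univ _, funext fun b => ?_⟩
    unfold cnt
    refine Finset.card_bij (fun i _ => σ i) (by simp) (by simp) ?_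
    intro i hi
    exact ⟨σ.symm i, by simpa using hi, by simp⟩
  have h := Finset.card_eq_sum_card_fiberwise hmaps
  rw [Finset.card_univ, Fintype.card_perm, Fintype.card_fin] at h
  rw [h, ← smul_eq_mul, ← Finset.sum_const]
  refine Finset.sum_congr rfl fun x hx => ?_
  have hx : cnt x = cnt x₀ := (Finset.mem_filter.1 hx).2
  have e : ∀ b, {i // x i = b} ≃ {i // x₀ i = b} := fun b =>
    Fintype.equivOfCardEq (by
      rw [Fintype.card_subtype, Fintype.card_subtype]; exact congrFun hx b)
  set σ₀ : Equiv.Perm (Fin n) := Equiv.ofFiberEquiv e with hσ₀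
  have hσ : ∀ i, x₀ (σ₀ i) = x i := Equiv.ofFiberEquiv_map e
  rw [← hstab]
  refine Finset.card_bij (fun σ _ => σ * σ₀) ?_ (by simp) ?_
  · intro σ h
    have h : x₀ ∘ σ = x₀ := (Finset.mem_filter.1 h).2
    rw [Finset.mem_filter]
    refine ⟨Finset.mem_univ _, funext fun i => ?_⟩
    have := congrFun h (σ₀ i)
    simpa [hσ] using this
  · intro τ h
    have h : x₀ ∘ τ = x := (Finset.mem_filter.1 h).2
    refine ⟨τ * σ₀⁻¹, ?_, by simp⟩
    rw [Finset.mem_filter]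
    refine ⟨Finset.mem_univ _, funext fun i => ?_⟩
    have h1 : x₀ (τ (σ₀.symm i)) = x (σ₀.symm i) := congrFun h (σ₀.symm i)
    have h2 := hσ (σ₀.symm i)
    rw [Equiv.apply_symm_apply] at h2
    exact h1.trans h2.symm

lemma pow_mul_factorial_le (k l : ℕ) : k ^ l * k.factorial ≤ k ^ k * l.factorial := by
  rcases le_total k l with h | h
  · calc k ^ l * k.factorial = k ^ k * (k.factorial * k ^ (l - k)) := by
          rw [← Nat.add_sub_cancel' h, pow_add]; simp; ring
      _ ≤ _ := Nat.mul_le_mul_left _ (Nat.factorial_mul_pow_sub_le_factorial h)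
  · have h1 := Nat.factorial_mul_descFactorial (Nat.sub_le k l)
    rw [Nat.sub_sub_self h] at h1
    calc k ^ l * k.factorial = k ^ l * (l.factorial * k.descFactorial (k - l)) := by rw [h1]
      _ ≤ k ^ l * (l.factorial * k ^ (k - l)) := by
          gcongr; exact Nat.descFactorial_le_pow _ _
      _ = k ^ l * k ^ (k - l) * l.factorial := by ring
      _ = _ := by rw [← pow_add, Nat.add_sub_cancel' h]

/-- Among all type classes, the class of `x₀` is the most likely under its own type. -/
lemma card_cnt_mul_prod_pow_le (x x₀ : Fin n → β) :
    (Finset.univ.filter fun y : Fin n → β => cnt y = cnt x).card * ∏ b, cnt x₀ b ^ cnt x b ≤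
      (Finset.univ.filter fun y : Fin n → β => cnt y = cnt x₀).card *
        ∏ b, cnt x₀ b ^ cnt x₀ b := by
  have h1 := card_cnt_eq_mul_prod_factorial x
  have h2 := card_cnt_eq_mul_prod_factorial x₀
  have h3 : (∏ b, cnt x₀ b ^ cnt x b) * ∏ b, (cnt x₀ b).factorial ≤
      (∏ b, cnt x₀ b ^ cnt x₀ b) * ∏ b, (cnt x b).factorial := by
    rw [← Finset.prod_mul_distrib, ← Finset.prod_mul_distrib]
    exact Finset.prod_le_prod' fun b _ => pow_mul_factorial_le _ _
  have p1 : 0 < ∏ b, (cnt x b).factorial := Finset.prod_pos fun b _ => Nat.factorial_pos _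
  have p2 : 0 < ∏ b, (cnt x₀ b).factorial := Finset.prod_pos fun b _ => Nat.factorial_pos _
  refine Nat.le_of_mul_le_mul_right ?_ (Nat.mul_pos p1 p2)
  set a := (Finset.univ.filter fun y : Fin n → β => cnt y = cnt x).card
  set a' := (Finset.univ.filter fun y : Fin n → β => cnt y = cnt x₀).card
  calc _ = (a * ∏ b, (cnt x b).factorial) *
        ((∏ b, cnt x₀ b ^ cnt x b) * ∏ b, (cnt x₀ b).factorial) := by ring
    _ ≤ (a * ∏ b, (cnt x b).factorial) *
        ((∏ b, cnt x₀ b ^ cnt x₀ b) * ∏ b, (cnt x b).factorial) := Nat.mul_le_mul_left _ h3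
    _ = (a' * ∏ b, (cnt x₀ b).factorial) *
        ((∏ b, cnt x₀ b ^ cnt x₀ b) * ∏ b, (cnt x b).factorial) := by rw [h1, h2]
    _ = _ := by ring

lemma card_image_cnt_le (S : Finset (Fin n → β)) :
    (S.image cnt).card ≤ (n + 1) ^ Fintype.card β := by
  have : S.image cnt ⊆ Fintype.piFinset fun _ : β => Finset.range (n + 1) := by
    intro k hk
    obtain ⟨x, -, rfl⟩ := Finset.mem_image.1 hk
    simp only [Fintype.mem_piFinset, Finset.mem_range]
    intro b
    have := cnt_le x b
    omega
  simpa using Finset.card_le_card this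

lemma pow_self_le_card_cnt (x₀ : Fin n → β) :
    n ^ n ≤ (n + 1) ^ Fintype.card β *
      ((Finset.univ.filter fun y : Fin n → β => cnt y = cnt x₀).card *
        ∏ b, cnt x₀ b ^ cnt x₀ b) := by
  have h1 : n ^ n = ∑ x : Fin n → β, ∏ b, cnt x₀ b ^ cnt x b := by
    have h := (Finset.prod_univ_sum (fun _ : Fin n => (Finset.univ : Finset β))
      (fun _ b => cnt x₀ b))
    simp only [sum_cnt, Finset.prod_const, Finset.card_univ, Fintype.card_fin,
      Fintype.piFinset_univ, prod_comp_cnt] at h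
    exact h
  have h2 : ∑ x : Fin n → β, ∏ b, cnt x₀ b ^ cnt x b =
      ∑ k ∈ Finset.univ.image (cnt : (Fin n → β) → β → ℕ),
        (Finset.univ.filter fun y : Fin n → β => cnt y = k).card * ∏ b, cnt x₀ b ^ k b := by
    rw [← Finset.sum_fiberwise_of_maps_to (g := cnt)
      (t := Finset.univ.image (cnt : (Fin n → β) → β → ℕ)) (by simp)]
    refine Finset.sum_congr rfl fun k _ => ?_
    rw [← smul_eq_mul, ← Finset.sum_const]
    exact Finset.sum_congr rfl fun x hx => by rw [(Finset.mem_filter.1 hx).2]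
  rw [h1, h2]
  refine (Finset.sum_le_card_nsmul _ _
    ((Finset.univ.filter fun y : Fin n → β => cnt y = cnt x₀).card * ∏ b, cnt x₀ b ^ cnt x₀ b)
    fun k hk => ?_).trans ?_
  · obtain ⟨x, -, rfl⟩ := Finset.mem_image.1 hk
    exact card_cnt_mul_prod_pow_le x x₀
  · rw [smul_eq_mul]
    exact Nat.mul_le_mul_right _ (card_image_cnt_le _)

lemma emp_eq (x : Fin n → β) (b : β) : emp n x b = cnt x b / n := rfl

/-- Lower bound on the size of a type class. -/
lemma exp_ent_le_card_typeClass (hn : 0 < n) {Q : β → ℝ} (hQ : IsDist Q) (hQn : IsTypeDist n Q) :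
    Real.exp (n * ent Q) ≤ ((n : ℝ) + 1) ^ Fintype.card β * (typeClass n Q).card := by
  have hn' : (0 : ℝ) < n := by exact_mod_cast hn
  choose k hk using hQn
  have hksum : ∑ b, k b = n := by
    have : ((∑ b, k b : ℕ) : ℝ) = n := by
      push_cast
      simp_rw [← hk, ← Finset.sum_mul, hQ.2, one_mul]
    exact_mod_cast this
  obtain ⟨x₀, hx₀⟩ := exists_cnt_eq k hksum
  have hclass : (Finset.univ.filter fun y : Fin n → β => cnt y = cnt x₀) = typeClass n Q := by
    unfold typeClass
    refine Finset.filter_congr fun y _ => ?_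
    rw [hx₀, funext_iff, funext_iff]
    refine forall_congr' fun b => ?_
    rw [emp_eq, div_eq_iff hn'.ne', hk]
    exact Nat.cast_inj.symm
  have h := pow_self_le_card_cnt x₀
  rw [hclass, hx₀] at h
  have h' : (n : ℝ) ^ n ≤ ((n : ℝ) + 1) ^ Fintype.card β *
      ((typeClass n Q).card * ∏ b, (k b : ℝ) ^ k b) := by exact_mod_cast h
  have hprod : ∏ b, (k b : ℝ) ^ k b = (n : ℝ) ^ n * Real.exp (-(n * ent Q)) := by
    have h1 : ∀ b, (k b : ℝ) ^ k b = (n : ℝ) ^ k b * Real.exp (n * (Q b * Real.log (Q b))) := by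
      intro b
      rcases Nat.eq_zero_or_pos (k b) with h0 | h0
      · have : Q b = 0 := by
          have := hk b
          rw [h0] at this
          simpa [hn'.ne'] using this
        simp [h0, this]
      · have hQpos : 0 < Q b := by
          have h2 : (0 : ℝ) < k b := by exact_mod_cast h0
          rw [← hk b] at h2
          exact pos_of_mul_pos_left h2 hn'.le
        rw [← mul_assoc, mul_comm (n : ℝ) (Q b), hk b, Real.exp_nat_mul, Real.exp_log hQpos,
          ← mul_pow, mul_comm (n : ℝ), hk b]
    simp_rw [h1]
    rw [Finset.prod_mul_distrib, Finset.prod_pow_eq_pow_sum, hksum, ← Real.exp_sum,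
      ← Finset.mul_sum]
    congr 2
    unfold ent
    ring
  rw [hprod] at h'
  have hnn : (0 : ℝ) < (n : ℝ) ^ n := by positivity
  have h2 : 1 ≤ ((n : ℝ) + 1) ^ Fintype.card β * (typeClass n Q).card *
      Real.exp (-(n * ent Q)) := by
    refine le_of_mul_le_mul_left ?_ hnn
    calc _ = (n : ℝ) ^ n := mul_one _
      _ ≤ _ := h'
      _ = _ := by ring
  rw [Real.exp_neg, ← div_eq_mul_inv, le_div_iff₀ (Real.exp_pos _), one_mul] at h2
  exact h2

/-- A set of sequences each of probability at least `r` has at most `1 / r` elements. -/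
lemma card_mul_le_one (w : Fin n → β → ℝ) (hw : ∀ i b, 0 ≤ w i b) (hw1 : ∀ i, ∑ b, w i b = 1)
    (S : Finset (Fin n → β)) {r : ℝ} (hr : ∀ z ∈ S, r ≤ ∏ i, w i (z i)) : S.card * r ≤ 1 := by
  have h := Finset.prod_univ_sum (fun _ : Fin n => (Finset.univ : Finset β)) w
  simp only [hw1, Finset.prod_const_one, Fintype.piFinset_univ] at h
  rw [h, ← nsmul_eq_mul, ← Finset.sum_const]
  exact (Finset.sum_le_sum hr).trans (Finset.sum_le_sum_of_subset_of_nonneg (Finset.subset_univ _)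
    fun z _ _ => Finset.prod_nonneg fun i _ => hw _ _)

lemma emp_pos (hn : 0 < n) (x : Fin n → β) (i : Fin n) : 0 < emp n x (x i) := by
  rw [emp_eq]
  have : 0 < cnt x (x i) := Finset.card_pos.2 ⟨i, by simp⟩
  positivity

lemma prod_eq_exp_sum_emp (hn : 0 < n) (x : Fin n → β) (f : β → ℝ) (hf : ∀ i, 0 < f (x i)) :
    ∏ i, f (x i) = Real.exp (n * ∑ b, emp n x b * Real.log (f b)) := by
  have hn' : (n : ℝ) ≠ 0 := by exact_mod_cast hn.ne'
  rw [Finset.prod_congr rfl fun i _ => (Real.exp_log (hf i)).symm, ← Real.exp_sum,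
    sum_comp_cnt x fun b => Real.log (f b), Finset.mul_sum]
  congr 1
  refine Finset.sum_congr rfl fun b _ => ?_
  rw [emp_eq]
  field_simp

/-- Upper bound on the size of a type class. -/
lemma card_typeClass_le (hn : 0 < n) {Q : β → ℝ} (hQ : IsDist Q) :
    ((typeClass n Q).card : ℝ) ≤ Real.exp (n * ent Q) := by
  have h := card_mul_le_one (fun _ : Fin n => Q) (fun _ => hQ.1) (fun _ => hQ.2) (typeClass n Q)
    (r := Real.exp (-(n * ent Q))) (by
      intro z hz
      have hz : emp n z = Q := (Finset.mem_filter.1 hz).2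
      rw [prod_eq_exp_sum_emp hn z Q fun i => by rw [← hz]; exact emp_pos hn z i, hz]
      unfold ent
      rw [mul_neg, neg_neg])
  rwa [Real.exp_neg, ← div_eq_mul_inv, div_le_one (Real.exp_pos _)] at h

end Types
end RGV

namespace RGV

section JointTypes

variable {α : Type} [Fintype α] {n : ℕ}

lemma emp2_eq_emp (x y : Fin n → α) : emp2 n x y = emp n fun i => (x i, y i) := by
  funext ab
  simp only [emp2, emp, Prod.ext_iff]

lemma emp2_swap (x y : Fin n → α) : (fun p : α × α => emp2 n x y (p.2, p.1)) = emp2 n y x := by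
  funext ab
  simp only [emp2, and_comm]

lemma isDist_emp (hn : 0 < n) {β : Type} [Fintype β] (x : Fin n → β) : IsDist (emp n x) := by
  have hn' : (n : ℝ) ≠ 0 := by exact_mod_cast hn.ne'
  refine ⟨fun b => by rw [emp_eq]; positivity, ?_⟩
  simp_rw [emp_eq]
  rw [← Finset.sum_div, ← Nat.cast_sum, sum_cnt, div_self hn']

lemma isTypeDist_emp (hn : 0 < n) {β : Type} [Fintype β] (x : Fin n → β) :
    IsTypeDist n (emp n x) := by
  have hn' : (n : ℝ) ≠ 0 := by exact_mod_cast hn.ne'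
  exact fun b => ⟨cnt x b, by rw [emp_eq, div_mul_cancel₀ _ hn']⟩

lemma sum_emp2_right (x y : Fin n → α) (a : α) : ∑ b, emp2 n x y (a, b) = emp n x a := by
  unfold emp2 emp
  rw [← Finset.sum_div, ← Nat.cast_sum]
  congr 2
  rw [Finset.card_eq_sum_card_fiberwise (f := y) (t := Finset.univ)
    fun _ _ => Finset.mem_coe.2 (Finset.mem_univ _)]
  simp only [Finset.filter_filter]

lemma sum_emp2_left (x y : Fin n → α) (b : α) : ∑ a, emp2 n x y (a, b) = emp n y b := by
  rw [← sum_emp2_right y x b, ← emp2_swap x y]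

lemma joint_emp2 (hn : 0 < n) {Q : α → ℝ} {x y : Fin n → α} (hx : x ∈ typeClass n Q)
    (hy : y ∈ typeClass n Q) : Joint Q (emp2 n x y) := by
  have hx : emp n x = Q := (Finset.mem_filter.1 hx).2
  have hy : emp n y = Q := (Finset.mem_filter.1 hy).2
  refine ⟨emp2_eq_emp x y ▸ isDist_emp hn _, fun a => ?_, fun b => ?_⟩
  · rw [sum_emp2_right, hx]
  · rw [sum_emp2_left, hy]

lemma Joint.swap {Q : α → ℝ} {P : α × α → ℝ} (hP : Joint Q P) :
    Joint Q fun p => P (p.2, p.1) := by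
  refine ⟨⟨fun p => hP.1.1 _, ?_⟩, hP.2.2, hP.2.1⟩
  rw [← hP.1.2]
  exact (Equiv.prodComm α α).sum_comp P

lemma mutInf_swap (P : α × α → ℝ) : mutInf (fun p : α × α => P (p.2, p.1)) = mutInf P := by
  unfold mutInf
  rw [← (Equiv.prodComm α α).sum_comp]
  refine Finset.sum_congr rfl fun p _ => ?_
  simp only [Equiv.prodComm_apply, Prod.fst_swap, Prod.snd_swap, Prod.mk.eta]
  rw [mul_comm (∑ b, P (b, p.2))]

lemma Joint.le_left {Q : α → ℝ} {P : α × α → ℝ} (hP : Joint Q P) (p : α × α) : P p ≤ Q p.1 := by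
  rw [← hP.2.1]
  exact Finset.single_le_sum (f := fun b => P (p.1, b)) (fun b _ => hP.1.1 _)
    (Finset.mem_univ p.2)

lemma Joint.le_right {Q : α → ℝ} {P : α × α → ℝ} (hP : Joint Q P) (p : α × α) : P p ≤ Q p.2 := by
  rw [← hP.2.2]
  exact Finset.single_le_sum (f := fun a => P (a, p.2)) (fun b _ => hP.1.1 _)
    (Finset.mem_univ p.1)

lemma Joint.sum_mul_fst {Q : α → ℝ} {P : α × α → ℝ} (hP : Joint Q P) (f : α → ℝ) :
    ∑ p, P p * f p.1 = ∑ a, Q a * f a := by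
  rw [Fintype.sum_prod_type]
  simp_rw [← Finset.sum_mul, hP.2.1]

lemma Joint.sum_mul_snd {Q : α → ℝ} {P : α × α → ℝ} (hP : Joint Q P) (f : α → ℝ) :
    ∑ p, P p * f p.2 = ∑ a, Q a * f a := by
  rw [Fintype.sum_prod_type, Finset.sum_comm]
  simp_rw [← Finset.sum_mul, hP.2.2]

lemma Joint.mutInf_eq {Q : α → ℝ} {P : α × α → ℝ} (hP : Joint Q P) :
    mutInf P = ∑ p, P p * Real.log (P p / Q p.2) + ent Q := by
  unfold mutInf ent
  rw [← hP.sum_mul_fst fun a => Real.log (Q a), ← sub_eq_add_neg, ← Finset.sum_sub_distrib]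
  refine Finset.sum_congr rfl fun p _ => ?_
  rw [hP.2.1, hP.2.2]
  rcases (hP.1.1 p).eq_or_lt with h | h
  · simp [← h]
  · have h1 := h.trans_le (hP.le_left p)
    have h2 := h.trans_le (hP.le_right p)
    rw [mul_comm (Q p.1), ← div_div, Real.log_div (by positivity) h1.ne']
    ring

/-- Chain rule for the entropy of a joint distribution. -/
lemma Joint.ent_eq {Q : α → ℝ} {P : α × α → ℝ} (hP : Joint Q P) :
    ent P = 2 * ent Q - mutInf P := by
  have h : ∑ p, P p * Real.log (P p / Q p.2) = -ent P + ent Q := by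
    unfold ent
    rw [← hP.sum_mul_snd fun a => Real.log (Q a), neg_neg, ← sub_eq_add_neg,
      ← Finset.sum_sub_distrib]
    refine Finset.sum_congr rfl fun p _ => ?_
    rcases (hP.1.1 p).eq_or_lt with h | h
    · simp [← h]
    · have h2 := h.trans_le (hP.le_right p)
      rw [Real.log_div h.ne' h2.ne']
      ring
  rw [hP.mutInf_eq, h]
  ring

/-- Upper bound on the size of a conditional type class. -/
lemma card_emp2_left_le (hn : 0 < n) {Q : α → ℝ} {P : α × α → ℝ} (hP : Joint Q P)
    {y : Fin n → α} (hy : y ∈ typeClass n Q) :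
    ((Finset.univ.filter fun z : Fin n → α => emp2 n z y = P).card : ℝ) ≤
      Real.exp (n * (ent Q - mutInf P)) := by
  have hy : emp n y = Q := (Finset.mem_filter.1 hy).2
  have hQ : ∀ i, 0 < Q (y i) := fun i => hy ▸ emp_pos hn y i
  have h := card_mul_le_one (fun i a => P (a, y i) / Q (y i))
    (fun i a => div_nonneg (hP.1.1 _) (hQ i).le)
    (fun i => by rw [← Finset.sum_div, hP.2.2, div_self (hQ i).ne'])
    (Finset.univ.filter fun z : Fin n → α => emp2 n z y = P)
    (r := Real.exp (-(n * (ent Q - mutInf P)))) (by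
      intro z hz
      have hz : emp2 n z y = P := (Finset.mem_filter.1 hz).2
      rw [emp2_eq_emp] at hz
      have h1 := prod_eq_exp_sum_emp hn (fun i => (z i, y i)) (fun p => P p / Q p.2)
        fun i => div_pos (by rw [← hz]; exact emp_pos hn (fun i => (z i, y i)) i) (hQ i)
      refine le_of_eq ?_
      rw [h1, hz, hP.mutInf_eq]
      congr 1
      ring)
  rwa [Real.exp_neg, ← div_eq_mul_inv, div_le_one (Real.exp_pos _)] at h

lemma card_emp2_right_le (hn : 0 < n) {Q : α → ℝ} {P : α × α → ℝ} (hP : Joint Q P)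
    {y : Fin n → α} (hy : y ∈ typeClass n Q) :
    ((Finset.univ.filter fun z : Fin n → α => emp2 n y z = P).card : ℝ) ≤
      Real.exp (n * (ent Q - mutInf P)) := by
  have h := card_emp2_left_le hn hP.swap hy
  rw [mutInf_swap] at h
  refine le_trans ?_ h
  rw [Nat.cast_le]
  refine Finset.card_le_card fun z hz => ?_
  rw [Finset.mem_filter] at hz ⊢
  exact ⟨Finset.mem_univ _, by rw [← emp2_swap, hz.2]⟩

/-- Lower bound on the number of pairs of sequences of a given joint type. -/
lemma exp_le_card_pairs (hn : 0 < n) {Q : α → ℝ} {P : α × α → ℝ} (hP : Joint Q P)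
    (hPn : IsTypeDist n P) :
    Real.exp (n * (2 * ent Q - mutInf P)) ≤ ((n : ℝ) + 1) ^ Fintype.card (α × α) *
      ((typeClass n Q ×ˢ typeClass n Q).filter fun q => emp2 n q.1 q.2 = P).card := by
  rw [← hP.ent_eq]
  refine (exp_ent_le_card_typeClass hn hP.1 hPn).trans ?_
  refine mul_le_mul_of_nonneg_left ?_ (by positivity)
  rw [Nat.cast_le]
  refine Finset.card_le_card_of_injOn (fun z => (fun i => (z i).1, fun i => (z i).2)) ?_ ?_
  · intro z hz
    have hz : emp n z = P := (Finset.mem_filter.1 hz).2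
    have h2 : emp2 n (fun i => (z i).1) (fun i => (z i).2) = P := by rw [emp2_eq_emp]; exact hz
    simp only [Finset.coe_filter, Finset.mem_product, Set.mem_ofPred_eq, typeClass,
      Finset.mem_filter, Finset.mem_univ, true_and]
    refine ⟨⟨funext fun a => ?_, funext fun b => ?_⟩, h2⟩
    · rw [← sum_emp2_right _ (fun i => (z i).2), h2, hP.2.1]
    · rw [← sum_emp2_left (fun i => (z i).1), h2, hP.2.2]
  · intro z _ z' _ h
    simp only [Prod.mk.injEq, funext_iff] at h
    exact funext fun i => Prod.ext (h.1 i) (h.2 i)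

lemma RateCond.le_mutInf {Q : α → ℝ} {d : (α × α → ℝ) → ℝ} {Δ R δ : ℝ}
    (h : RateCond n Q d Δ R δ) {P : α × α → ℝ} (hP : Joint Q P) (hPn : IsTypeDist n P)
    (hPd : d P ≤ Δ) : R + 2 * δ ≤ mutInf P := by
  have h1 : ((R : ℝ) : EReal) ≤ ((mutInf P : ℝ) : EReal) - ((2 * δ : ℝ) : EReal) :=
    h.trans (EReal.sub_le_sub (sInf_le ⟨P, hP, hPn, hPd, rfl⟩) le_rfl)
  rw [← EReal.coe_sub, EReal.coe_le_coe_iff] at h1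
  linarith

/-- Under the rate condition few sequences are too close to a given one. -/
lemma card_bad_le (hn : 0 < n) {Q : α → ℝ} {d : (α × α → ℝ) → ℝ} {Δ R δ : ℝ}
    (h : RateCond n Q d Δ R δ) {y : Fin n → α} (hy : y ∈ typeClass n Q) :
    (((typeClass n Q).filter fun z => ¬ Δ < d (emp2 n z y)).card : ℝ) ≤
      ((n : ℝ) + 1) ^ Fintype.card (α × α) * Real.exp (n * (ent Q - R - 2 * δ)) := by
  set S := (typeClass n Q).filter fun z => ¬ Δ < d (emp2 n z y) with hS
  set S' := S.image fun z i => (z i, y i)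
  have hcard : S'.card = S.card := Finset.card_image_of_injective _ fun z z' h =>
    funext fun i => (Prod.ext_iff.1 (congrFun h i)).1
  rw [← hcard, Finset.card_eq_sum_card_image cnt S', Nat.cast_sum]
  refine (Finset.sum_le_card_nsmul _ _ (Real.exp (n * (ent Q - R - 2 * δ))) ?_).trans ?_
  · intro k hk
    obtain ⟨w, hw, rfl⟩ := Finset.mem_image.1 hk
    obtain ⟨z₀, hz₀, rfl⟩ := Finset.mem_image.1 hw
    have hz₀ := Finset.mem_filter.1 hz₀
    have hJ := joint_emp2 hn hz₀.1 hy
    have hI := h.le_mutInf hJ (emp2_eq_emp z₀ y ▸ isTypeDist_emp hn _) (not_lt.1 hz₀.2)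
    refine le_trans ?_ ((card_emp2_left_le hn hJ hy).trans (Real.exp_le_exp.2
      (mul_le_mul_of_nonneg_left (by linarith) (Nat.cast_nonneg n))))
    rw [Nat.cast_le]
    refine Finset.card_le_card_of_injOn (fun w i => (w i).1) ?_ ?_
    · intro w hw
      obtain ⟨hw, hc⟩ := Finset.mem_filter.1 (Finset.mem_coe.1 hw)
      obtain ⟨z, -, rfl⟩ := Finset.mem_image.1 hw
      simp only [Finset.coe_filter, Finset.mem_univ, true_and, Set.mem_ofPred_eq]
      rw [emp2_eq_emp, emp2_eq_emp]
      funext p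
      rw [emp_eq, emp_eq, hc]
    · intro w hw w' hw' heq
      obtain ⟨z, -, rfl⟩ := Finset.mem_image.1 (Finset.mem_filter.1 (Finset.mem_coe.1 hw)).1
      obtain ⟨z', -, rfl⟩ := Finset.mem_image.1 (Finset.mem_filter.1 (Finset.mem_coe.1 hw')).1
      exact funext fun i => Prod.ext (congrFun heq i) rfl
  · rw [nsmul_eq_mul]
    refine mul_le_mul_of_nonneg_right ?_ (Real.exp_pos _).le
    exact_mod_cast card_image_cnt_le S'

end JointTypes
end RGV

namespace RGV

section Enumerator

variable {α : Type} [Fintype α] {n : ℕ} {Q : α → ℝ} {d : (α × α → ℝ) → ℝ} {Δ R δ : ℝ}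
  {P : α × α → ℝ}

lemma nenum_eq_edgeCount {M : ℕ} (c : Fin M → Fin n → α) :
    (Nenum n P c : ℝ) = edgeCount (fun x y => emp2 n x y = P) c := by
  unfold Nenum edgeCount edgeInd
  rw [Finset.natCast_card_filter]
  refine Finset.sum_congr rfl fun e _ => ?_
  congr!

lemma prob_eq_seqE {M : ℕ} (S : (Fin M → Fin n → α) → Prop) :
    prob n Q d Δ M S = seqE (typeClass n Q) (fun z y => Δ < d (emp2 n z y)) M
      fun c => if S c then 1 else 0 := by
  unfold prob seqE
  refine Finset.sum_congr rfl fun c _ => ?_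
  have h : rgvProb n Q d Δ c = seqWt (typeClass n Q) (fun z y => Δ < d (emp2 n z y)) c := by
    unfold rgvProb seqWt unifWt feasible feasSet
    congr!
  rw [mul_ite, mul_one, mul_zero, h]

lemma Mof_le (hR : 0 < R) : (Mof R n : ℝ) ≤ 2 * Real.exp (n * R) := by
  have h1 : 1 ≤ Real.exp (n * R) := Real.one_le_exp (by positivity)
  have h2 := (Nat.ceil_lt_add_one (Real.exp_pos (n * R)).le).le
  unfold Mof
  linarith

lemma exp_le_Mof : Real.exp (n * R) ≤ Mof R n := Nat.le_ceil _

lemma two_le_Mof (hn : 0 < n) (hR : 0 < R) : 2 ≤ Mof R n := by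
  have hn' : (0 : ℝ) < n := by exact_mod_cast hn
  have h : 1 < Real.exp (n * R) := Real.one_lt_exp_iff.2 (by positivity)
  exact Nat.lt_ceil.2 (by simpa using h)

/-- A polynomial factor dominating all the type-counting corrections. -/
def polyFactor (α : Type) [Fintype α] (n : ℕ) : ℝ :=
  ((n : ℝ) + 1) ^ (Fintype.card α + Fintype.card (α × α))

lemma pow_card_le_polyFactor (α : Type) [Fintype α] (n : ℕ) :
    ((n : ℝ) + 1) ^ Fintype.card α ≤ polyFactor α n :=
  pow_le_pow_right₀ (by linarith [(Nat.cast_nonneg n : (0 : ℝ) ≤ n)]) (Nat.le_add_right _ _)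

lemma pow_card_prod_le_polyFactor (α : Type) [Fintype α] (n : ℕ) :
    ((n : ℝ) + 1) ^ Fintype.card (α × α) ≤ polyFactor α n :=
  pow_le_pow_right₀ (by linarith [(Nat.cast_nonneg n : (0 : ℝ) ≤ n)]) (Nat.le_add_left _ _)

lemma one_le_polyFactor (α : Type) [Fintype α] (n : ℕ) : 1 ≤ polyFactor α n :=
  one_le_pow₀ (by linarith [(Nat.cast_nonneg n : (0 : ℝ) ≤ n)])

/-- The rate condition, once the blocklength beats the polynomial factor, makes the excluded
balls small compared with the type class. -/
lemma exists_card_bad_le (hn : 0 < n) (hQ : IsDist Q) (hQn : IsTypeDist n Q) (hd : IsDistance d)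
    (hR : 0 < R) (hrate : RateCond n Q d Δ R δ)
    (hbig : 24 * polyFactor α n ≤ Real.exp (n * (2 * δ))) :
    ∃ K : ℕ, (∀ y ∈ typeClass n Q,
        ((typeClass n Q).filter fun z => ¬ Δ < d (emp2 n z y)).card ≤ K) ∧
      (∀ y ∈ typeClass n Q,
        ((typeClass n Q).filter fun z => ¬ Δ < d (emp2 n y z)).card ≤ K) ∧
      12 * Mof R n * K ≤ (typeClass n Q).card := by
  have hbad : ∀ y ∈ typeClass n Q,
      ((typeClass n Q).filter fun z => ¬ Δ < d (emp2 n z y)).card ≤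
        ⌊((n : ℝ) + 1) ^ Fintype.card (α × α) * Real.exp (n * (ent Q - R - 2 * δ))⌋₊ :=
    fun y hy => Nat.le_floor (card_bad_le hn hrate hy)
  refine ⟨_, hbad, fun y hy => ?_, ?_⟩
  · refine le_trans (le_of_eq ?_) (hbad y hy)
    congr 1
    refine Finset.filter_congr fun z _ => ?_
    rw [← emp2_swap z y, hd.2]
  · set B := ((n : ℝ) + 1) ^ Fintype.card (α × α) * Real.exp (n * (ent Q - R - 2 * δ)) with hB
    have hB0 : 0 ≤ B := by positivity
    have hT := exp_ent_le_card_typeClass hn hQ hQn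
    have hfl := Nat.floor_le hB0
    have hM := Mof_le (n := n) hR
    have h : (12 * Mof R n * ⌊B⌋₊ : ℝ) ≤ (typeClass n Q).card := by
      calc (12 * Mof R n * ⌊B⌋₊ : ℝ) ≤ 12 * (2 * Real.exp (n * R)) * B := by gcongr
        _ = 24 * ((n : ℝ) + 1) ^ Fintype.card (α × α) * Real.exp (n * ent Q) *
            Real.exp (-(n * (2 * δ))) := by
              have : Real.exp (n * (ent Q - R - 2 * δ)) = Real.exp (n * ent Q) *
                  Real.exp (-(n * (2 * δ))) * Real.exp (-(n * R)) := by
                rw [← Real.exp_add, ← Real.exp_add]; congr 1; ring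
              have h2 : Real.exp (n * R) * Real.exp (-(n * R)) = 1 := by
                rw [← Real.exp_add, add_neg_cancel, Real.exp_zero]
              rw [hB, this]
              linear_combination (24 * ((n : ℝ) + 1) ^ Fintype.card (α × α) *
                Real.exp (n * ent Q) * Real.exp (-(n * (2 * δ)))) * h2
        _ ≤ 24 * ((n : ℝ) + 1) ^ Fintype.card (α × α) *
            (((n : ℝ) + 1) ^ Fintype.card α * (typeClass n Q).card) *
            Real.exp (-(n * (2 * δ))) := by gcongr
        _ = 24 * polyFactor α n * Real.exp (-(n * (2 * δ))) * (typeClass n Q).card := by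
              rw [polyFactor, pow_add]; ring
        _ ≤ Real.exp (n * (2 * δ)) * Real.exp (-(n * (2 * δ))) * (typeClass n Q).card := by
              gcongr
        _ = (typeClass n Q).card := by
              rw [← Real.exp_add, add_neg_cancel, Real.exp_zero, one_mul]
    exact_mod_cast h

lemma card_typeClass_pos (hn : 0 < n) (hQ : IsDist Q) (hQn : IsTypeDist n Q) :
    0 < (typeClass n Q).card := by
  have h := (Real.exp_pos _).trans_le (exp_ent_le_card_typeClass hn hQ hQn)
  exact_mod_cast pos_of_mul_pos_right h (by positivity)

lemma seqE_rgv_one (hn : 0 < n) (hQ : IsDist Q) (hQn : IsTypeDist n Q) (hd : IsDistance d)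
    (hR : 0 < R) (hrate : RateCond n Q d Δ R δ)
    (hbig : 24 * polyFactor α n ≤ Real.exp (n * (2 * δ))) :
    seqE (typeClass n Q) (fun z y => Δ < d (emp2 n z y)) (Mof R n) (fun _ => 1) = 1 := by
  obtain ⟨K, hK, -, hM⟩ := exists_card_bad_le hn hQ hQn hd hR hrate hbig
  exact seqE_one (Finset.card_pos.1 (card_typeClass_pos hn hQ hQn)) hK ((Nat.mul_le_mul_right _ (Nat.mul_le_mul_right _ (by norm_num))).trans hM)

/-- Moments of the type enumerator. -/
lemma seqE_nenum_pow_le (hn : 0 < n) (hQ : IsDist Q) (hQn : IsTypeDist n Q) (hd : IsDistance d)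
    (hR : 0 < R) (hrate : RateCond n Q d Δ R δ) (hP : Joint Q P)
    (hbig : 24 * polyFactor α n ≤ Real.exp (n * (2 * δ))) (k : ℕ) :
    seqE (typeClass n Q) (fun z y => Δ < d (emp2 n z y)) (Mof R n)
        (fun c => (Nenum n P c : ℝ) ^ k) ≤
      4 ^ k * ∏ j ∈ Finset.range k,
        (4 * polyFactor α n * Real.exp (n * (2 * R - mutInf P)) + (2 * j) ^ 2) := by
  obtain ⟨K, hK, -, hM⟩ := exists_card_bad_le hn hQ hQn hd hR hrate hbig
  have hT := exp_ent_le_card_typeClass hn hQ hQn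
  set p := ((n : ℝ) + 1) ^ Fintype.card α * Real.exp (-(n * mutInf P)) with hp
  have hcard : Real.exp (n * (ent Q - mutInf P)) ≤ p * (typeClass n Q).card := by
    calc Real.exp (n * (ent Q - mutInf P)) =
        Real.exp (n * ent Q) * Real.exp (-(n * mutInf P)) := by
          rw [← Real.exp_add]; congr 1; ring
      _ ≤ (((n : ℝ) + 1) ^ Fintype.card α * (typeClass n Q).card) *
          Real.exp (-(n * mutInf P)) := by gcongr
      _ = _ := by rw [hp]; ring
  have hleft : ∀ y ∈ typeClass n Q,
      (((typeClass n Q).filter fun x => emp2 n x y = P).card : ℝ) ≤ p * (typeClass n Q).card :=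
    fun y hy => (Nat.cast_le.2 (Finset.card_le_card (Finset.filter_subset_filter _
      (Finset.subset_univ _)))).trans ((card_emp2_left_le hn hP hy).trans hcard)
  have hright : ∀ x ∈ typeClass n Q,
      (((typeClass n Q).filter fun y => emp2 n x y = P).card : ℝ) ≤ p * (typeClass n Q).card :=
    fun y hy => (Nat.cast_le.2 (Finset.card_le_card (Finset.filter_subset_filter _
      (Finset.subset_univ _)))).trans ((card_emp2_right_le hn hP hy).trans hcard)
  have h := seqE_edgeCount_pow_le (A := fun x y => emp2 n x y = P) (p := p)
    (good := fun z y => Δ < d (emp2 n z y)) (M := Mof R n) (K := K)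
    (Finset.card_pos.1 (card_typeClass_pos hn hQ hQn)) hK ((Nat.mul_le_mul_right _ (Nat.mul_le_mul_right _ (by norm_num))).trans hM) (by positivity)
    (fun y hy => by convert hleft y hy) (fun x hx => by convert hright x hx) k
  simp_rw [nenum_eq_edgeCount]
  refine h.trans ?_
  have ha : (Mof R n : ℝ) ^ 2 * p ≤
      4 * polyFactor α n * Real.exp (n * (2 * R - mutInf P)) := by
    have hM := Mof_le (n := n) hR
    calc (Mof R n : ℝ) ^ 2 * p ≤ (2 * Real.exp (n * R)) ^ 2 *
        (polyFactor α n * Real.exp (-(n * mutInf P))) := by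
          rw [hp]; gcongr; exact pow_card_le_polyFactor α n
      _ = 4 * polyFactor α n *
          (Real.exp (n * R) * Real.exp (n * R) * Real.exp (-(n * mutInf P))) := by ring
      _ = _ := by rw [← Real.exp_add, ← Real.exp_add]; congr 2; ring
  refine mul_le_mul_of_nonneg_left (Finset.prod_le_prod (fun j _ => by positivity) fun j _ => ?_)
    (by positivity)
  linarith

/-- Lower bound on the mean of the type enumerator. -/
lemma le_seqE_nenum (hn : 0 < n) (hQ : IsDist Q) (hQn : IsTypeDist n Q) (hd : IsDistance d)
    (hR : 0 < R) (hrate : RateCond n Q d Δ R δ) (hP : Joint Q P) (hPn : IsTypeDist n P)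
    (hPd : Δ < d P) (hbig : 24 * polyFactor α n ≤ Real.exp (n * (2 * δ))) :
    Real.exp (n * (2 * R - mutInf P)) / (8 * polyFactor α n) ≤
      seqE (typeClass n Q) (fun z y => Δ < d (emp2 n z y)) (Mof R n)
        (fun c => (Nenum n P c : ℝ)) := by
  obtain ⟨K, hK, hK', hM⟩ := exists_card_bad_le hn hQ hQn hd hR hrate hbig
  have hTpos : (0 : ℝ) < (typeClass n Q).card := by
    exact_mod_cast card_typeClass_pos hn hQ hQn
  have h := le_seqE_edgeCount (A := fun x y => emp2 n x y = P)
    (good := fun z y => Δ < d (emp2 n z y)) (M := Mof R n)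
    (Finset.card_pos.1 (card_typeClass_pos hn hQ hQn)) hK hM hK' (two_le_Mof hn hR)
    (fun x y hxy => by
      rw [← emp2_swap x y, hd.2, hxy]; exact hPd)
  simp_rw [nenum_eq_edgeCount]
  refine le_trans ?_ h
  have hpairs := exp_le_card_pairs hn hP hPn
  have hle := card_typeClass_le hn hQ
  have hMl := exp_le_Mof (n := n) (R := R)
  have hπ : 0 < polyFactor α n := zero_lt_one.trans_le (one_le_polyFactor α n)
  set N := (((typeClass n Q ×ˢ typeClass n Q).filter fun q => emp2 n q.1 q.2 = P).card : ℝ)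
    with hN
  rw [div_le_div_iff₀ (by positivity) (by positivity)]
  calc Real.exp (n * (2 * R - mutInf P)) * (8 * ((typeClass n Q).card : ℝ) ^ 2)
      ≤ Real.exp (n * (2 * R - mutInf P)) * (8 * Real.exp (n * ent Q) ^ 2) := by gcongr
    _ = 8 * (Real.exp (n * R) ^ 2 * Real.exp (n * (2 * ent Q - mutInf P))) := by
        have : ∀ x : ℝ, Real.exp x ^ 2 = Real.exp (x + x) := fun x => by
          rw [Real.exp_add, sq]
        rw [this, this, mul_left_comm, ← Real.exp_add, ← Real.exp_add]
        congr 2; ring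
    _ ≤ 8 * ((Mof R n : ℝ) ^ 2 * (((n : ℝ) + 1) ^ Fintype.card (α × α) * N)) := by gcongr
    _ ≤ 8 * ((Mof R n : ℝ) ^ 2 * (polyFactor α n * N)) := by
        gcongr; exact pow_card_prod_le_polyFactor α n
    _ = (Mof R n : ℝ) ^ 2 * N * (8 * polyFactor α n) := by ring
    _ = _ := by rw [hN]; congr!

lemma prob_le_one (hn : 0 < n) (hQ : IsDist Q) (hQn : IsTypeDist n Q) (hd : IsDistance d)
    (hR : 0 < R) (hrate : RateCond n Q d Δ R δ)
    (hbig : 24 * polyFactor α n ≤ Real.exp (n * (2 * δ)))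
    (S : (Fin (Mof R n) → Fin n → α) → Prop) : prob n Q d Δ (Mof R n) S ≤ 1 := by
  rw [prob_eq_seqE]
  refine (seqE_mono _ _ fun c _ => ?_).trans (seqE_rgv_one hn hQ hQn hd hR hrate hbig).le
  split_ifs <;> norm_num

lemma prob_nenum_le (hn : 0 < n) (hQ : IsDist Q) (hQn : IsTypeDist n Q) (hd : IsDistance d)
    (hR : 0 < R) (hrate : RateCond n Q d Δ R δ) (hP : Joint Q P)
    (hbig : 24 * polyFactor α n ≤ Real.exp (n * (2 * δ))) (s : ℝ) :
    prob n Q d Δ (Mof R n) (fun c => Real.exp (n * s) ≤ (Nenum n P c : ℝ)) ≤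
      16 * polyFactor α n * Real.exp (n * -pos (mutInf P - 2 * R)) := by
  have hπ := one_le_polyFactor α n
  rcases le_total (mutInf P - 2 * R) 0 with h | h
  · refine (prob_le_one hn hQ hQn hd hR hrate hbig _).trans ?_
    rw [pos, max_eq_right h, neg_zero, mul_zero, Real.exp_zero]
    linarith
  · rw [pos, max_eq_left h, prob_eq_seqE, neg_sub]
    have h1 := seqE_nenum_pow_le hn hQ hQn hd hR hrate hP hbig 1
    simp only [pow_one, Finset.prod_range_one, Nat.cast_zero, mul_zero, ne_eq,
      OfNat.ofNat_ne_zero, not_false_eq_true, zero_pow, add_zero] at h1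
    refine le_trans (seqE_mono _ _ fun c _ => ?_) (h1.trans (le_of_eq (by ring)))
    split_ifs with hc
    · have : (0 : ℝ) < Nenum n P c := (Real.exp_pos _).trans_le hc
      exact_mod_cast this
    · positivity

lemma prob_nenum_le_pow (hn : 0 < n) (hQ : IsDist Q) (hQn : IsTypeDist n Q) (hd : IsDistance d)
    (hR : 0 < R) (hrate : RateCond n Q d Δ R δ) (hP : Joint Q P)
    (hbig : 24 * polyFactor α n ≤ Real.exp (n * (2 * δ))) (s : ℝ) (k : ℕ) :
    prob n Q d Δ (Mof R n) (fun c => Real.exp (n * s) ≤ (Nenum n P c : ℝ)) ≤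
      (16 * (1 + (k : ℝ) ^ 2) * polyFactor α n *
        Real.exp (n * (pos (2 * R - mutInf P) - s))) ^ k := by
  have hπ := one_le_polyFactor α n
  have h1 := pow_mul_seqE_le (T := typeClass n Q) (good := fun z y => Δ < d (emp2 n z y))
    (M := Mof R n) (Y := fun c => (Nenum n P c : ℝ)) (fun c => Nat.cast_nonneg _)
    (Real.exp_pos (n * s)).le k
  have h2 := h1.trans (seqE_nenum_pow_le hn hQ hQn hd hR hrate hP hbig k)
  rw [← prob_eq_seqE] at h2
  set E := Real.exp (n * pos (2 * R - mutInf P)) with hE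
  have hE1 : 1 ≤ E := Real.one_le_exp (mul_nonneg (Nat.cast_nonneg n) (le_max_right _ _))
  have hEθ : Real.exp (n * (2 * R - mutInf P)) ≤ E :=
    Real.exp_le_exp.2 (mul_le_mul_of_nonneg_left (le_max_left _ _) (Nat.cast_nonneg n))
  have h3 : ∏ j ∈ Finset.range k,
      (4 * polyFactor α n * Real.exp (n * (2 * R - mutInf P)) + (2 * (j : ℝ)) ^ 2) ≤
      (4 * (1 + (k : ℝ) ^ 2) * polyFactor α n * E) ^ k := by
    refine (Finset.prod_le_prod (fun j _ => by positivity) fun j hj => ?_).trans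
      (le_of_eq (by rw [Finset.prod_const, Finset.card_range]))
    have hjk : (j : ℝ) ≤ k := by exact_mod_cast (Finset.mem_range.1 hj).le
    have hπE : 1 ≤ polyFactor α n * E := one_le_mul_of_one_le_of_one_le hπ hE1
    calc _ ≤ 4 * polyFactor α n * E + (2 * (k : ℝ)) ^ 2 * 1 := by
          rw [mul_one]; gcongr
      _ ≤ 4 * polyFactor α n * E + (2 * (k : ℝ)) ^ 2 * (polyFactor α n * E) := by gcongr
      _ = _ := by ring
  have h4 : Real.exp (n * s) ^ k *
      prob n Q d Δ (Mof R n) (fun c => Real.exp (n * s) ≤ (Nenum n P c : ℝ)) ≤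
      (16 * (1 + (k : ℝ) ^ 2) * polyFactor α n * E) ^ k := by
    refine h2.trans ((mul_le_mul_of_nonneg_left h3 (by positivity)).trans (le_of_eq ?_))
    rw [← mul_pow]
    congr 1
    ring
  have h5 : Real.exp (n * (pos (2 * R - mutInf P) - s)) = E / Real.exp (n * s) := by
    rw [hE, ← Real.exp_sub, mul_sub]
  rw [h5, ← mul_div_assoc, div_pow, le_div_iff₀ (by positivity), mul_comm]
  exact h4

lemma le_prob_nenum (hn : 0 < n) (hQ : IsDist Q) (hQn : IsTypeDist n Q) (hd : IsDistance d)
    (hR : 0 < R) (hrate : RateCond n Q d Δ R δ) (hP : Joint Q P) (hPn : IsTypeDist n P)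
    (hPd : Δ < d P) (hbig : 24 * polyFactor α n ≤ Real.exp (n * (2 * δ))) {s : ℝ}
    (hs : s < 0 ∨
      16 * polyFactor α n * Real.exp (n * s) ≤ Real.exp (n * (2 * R - mutInf P))) :
    Real.exp (n * -pos (mutInf P - 2 * R)) ≤ 2 ^ 17 * polyFactor α n ^ 4 *
      prob n Q d Δ (Mof R n) (fun c => Real.exp (n * s) ≤ (Nenum n P c : ℝ)) := by
  have hπ := one_le_polyFactor α n
  have hπ0 : 0 < polyFactor α n := by linarith
  have hmean := le_seqE_nenum hn hQ hQn hd hR hrate hP hPn hPd hbig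
  have hsq := seqE_nenum_pow_le hn hQ hQn hd hR hrate hP hbig 2
  set θ := 2 * R - mutInf P with hθ
  set m := seqE (typeClass n Q) (fun z y => Δ < d (emp2 n z y)) (Mof R n)
    (fun c => (Nenum n P c : ℝ)) with hm
  have hm0 : 0 < m := lt_of_lt_of_le (by positivity) hmean
  have hPZ := sq_seqE_le_mul (seqE_rgv_one hn hQ hQn hd hR hrate hbig)
    (fun c => (Nenum n P c : ℝ)) hm0.le
  rw [← hm, ← prob_eq_seqE] at hPZ
  have hmono : prob n Q d Δ (Mof R n) (fun c => m / 2 ≤ (Nenum n P c : ℝ)) ≤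
      prob n Q d Δ (Mof R n) (fun c => Real.exp (n * s) ≤ (Nenum n P c : ℝ)) := by
    rw [prob_eq_seqE, prob_eq_seqE]
    refine seqE_mono _ _ fun c _ => ?_
    by_cases hc : m / 2 ≤ (Nenum n P c : ℝ)
    · rw [if_pos hc, if_pos]
      rcases hs with hs | hs
      · have h1 : (0 : ℝ) < Nenum n P c := lt_of_lt_of_le (by positivity) hc
        have h2 : (1 : ℝ) ≤ Nenum n P c := by exact_mod_cast h1
        exact (Real.exp_le_one_iff.2
          (mul_nonpos_of_nonneg_of_nonpos (Nat.cast_nonneg n) hs.le)).trans h2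
      · refine le_trans ?_ hc
        have h1 : Real.exp (n * s) ≤ Real.exp (n * θ) / (16 * polyFactor α n) := by
          rw [le_div_iff₀ (by positivity)]
          linarith
        have h2 : Real.exp (n * θ) / (16 * polyFactor α n) =
            Real.exp (n * θ) / (8 * polyFactor α n) / 2 := by
          rw [div_div]; congr 1; ring
        linarith
    · rw [if_neg hc]
      split_ifs <;> norm_num
  set p := prob n Q d Δ (Mof R n) (fun c => Real.exp (n * s) ≤ (Nenum n P c : ℝ))
  have hp0 : 0 ≤ prob n Q d Δ (Mof R n) (fun c => m / 2 ≤ (Nenum n P c : ℝ)) := by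
    rw [prob_eq_seqE]
    exact seqE_nonneg _ _ fun c => by split_ifs <;> norm_num
  set F := Real.exp (n * θ) with hF
  set E := Real.exp (n * pos θ) with hE
  have hE1 : 1 ≤ E := Real.one_le_exp (mul_nonneg (Nat.cast_nonneg n) (le_max_right _ _))
  have hF0 : 0 < F := Real.exp_pos _
  have hFE : F ≤ E :=
    Real.exp_le_exp.2 (mul_le_mul_of_nonneg_left (le_max_left _ _) (Nat.cast_nonneg n))
  have hsq' : seqE (typeClass n Q) (fun z y => Δ < d (emp2 n z y)) (Mof R n)
      (fun c => (Nenum n P c : ℝ) ^ 2) ≤ 512 * polyFactor α n ^ 2 * F * E := by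
    refine hsq.trans ?_
    have hπE : 1 ≤ polyFactor α n * E := one_le_mul_of_one_le_of_one_le hπ hE1
    rw [Finset.prod_range_succ, Finset.prod_range_one]
    push_cast
    calc (4 : ℝ) ^ 2 * ((4 * polyFactor α n * F + (2 * 0) ^ 2) *
          (4 * polyFactor α n * F + (2 * 1) ^ 2))
        = 256 * polyFactor α n * F * (polyFactor α n * F + 1) := by ring
      _ ≤ 256 * polyFactor α n * F * (polyFactor α n * E + polyFactor α n * E) := by gcongr
      _ = _ := by ring
  have key : (F / (16 * polyFactor α n)) ^ 2 ≤ p * (512 * polyFactor α n ^ 2 * F * E) := by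
    calc (F / (16 * polyFactor α n)) ^ 2 = (F / (8 * polyFactor α n) / 2) ^ 2 := by
          rw [div_div]; congr 2; ring
      _ ≤ (m / 2) ^ 2 := by gcongr
      _ ≤ _ := hPZ
      _ ≤ prob n Q d Δ (Mof R n) (fun c => m / 2 ≤ (Nenum n P c : ℝ)) *
          (512 * polyFactor α n ^ 2 * F * E) := by gcongr
      _ ≤ _ := by gcongr
  have hexp : Real.exp (n * -pos (mutInf P - 2 * R)) = F / E := by
    rw [hF, hE, ← Real.exp_sub, ← mul_sub]
    congr 2
    have : mutInf P - 2 * R = -θ := by rw [hθ]; ring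
    rw [this, pos, pos]
    rcases le_total θ 0 with h | h
    · rw [max_eq_left (by linarith), max_eq_right h]; ring
    · rw [max_eq_right (by linarith), max_eq_left h]; ring
  rw [hexp, div_le_iff₀ (by positivity)]
  rw [div_pow, div_le_iff₀ (by positivity)] at key
  refine le_of_mul_le_mul_left ?_ hF0
  calc F * F = F ^ 2 := by ring
    _ ≤ _ := key
    _ = _ := by ring

end Enumerator
end RGV

namespace RGV

section Asymptotics

lemma tendsto_log_polyFactor_div (α : Type) [Fintype α] {C : ℝ} (hC : 0 < C) (k : ℕ) :
    Tendsto (fun n : ℕ => Real.log (C * polyFactor α n ^ k) / n) atTop (nhds 0) := by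
  set m := (Fintype.card α + Fintype.card (α × α)) * k
  have h1 : Tendsto (fun n : ℕ => Real.log ((n : ℝ) + 1) / n) atTop (nhds 0) := by
    have h := (Real.isLittleO_log_id_atTop.tendsto_div_nhds_zero.comp
      (tendsto_atTop_add_const_right atTop (1 : ℝ) tendsto_natCast_atTop_atTop)).mul
      ((tendsto_inv_atTop_nhds_zero_nat (𝕜 := ℝ)).const_add 1)
    rw [zero_mul] at h
    refine h.congr' ?_
    filter_upwards [eventually_gt_atTop 0] with n hn
    have hn' : (0 : ℝ) < n := by exact_mod_cast hn
    simp only [Function.comp_apply, id]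
    field_simp
  have h2 : Tendsto (fun n : ℕ => Real.log C * (n : ℝ)⁻¹ + m * (Real.log ((n : ℝ) + 1) / n)) atTop
      (nhds 0) := by
    simpa using ((tendsto_inv_atTop_nhds_zero_nat (𝕜 := ℝ)).const_mul (Real.log C)).add
      (h1.const_mul (m : ℝ))
  refine h2.congr fun n => ?_
  have h3 : polyFactor α n ^ k = ((n : ℝ) + 1) ^ m := by rw [polyFactor, ← pow_mul]
  have h4 : (0 : ℝ) < (n : ℝ) + 1 := by positivity
  rw [h3, Real.log_mul hC.ne' (by positivity), Real.log_pow]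
  ring

lemma eventually_polyFactor_le_exp (α : Type) [Fintype α] {C ε : ℝ} (hC : 0 < C) (hε : 0 < ε) :
    ∀ᶠ n : ℕ in atTop, C * polyFactor α n ≤ Real.exp (n * ε) := by
  have h := tendsto_log_polyFactor_div α hC 1
  filter_upwards [h.eventually_lt_const hε, eventually_gt_atTop 0] with n hlt hn
  have hn' : (0 : ℝ) < n := by exact_mod_cast hn
  have hπ := one_le_polyFactor α n
  rw [pow_one, div_lt_iff₀ hn', mul_comm ε] at hlt
  exact (Real.log_le_iff_le_exp (by positivity)).1 hlt.le

lemma tendsto_nseq {D : ℕ} (hD : 0 < D) : Tendsto (nseq D) atTop atTop :=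
  tendsto_atTop_mono (fun t => t.le_succ.trans (Nat.le_mul_of_pos_left _ hD)) tendsto_id

lemma nseq_pos {D : ℕ} (hD : 0 < D) (t : ℕ) : 0 < nseq D t := Nat.mul_pos hD t.succ_pos

lemma IsTypeDist.nseq {β : Type} {p : β → ℝ} {D : ℕ} (h : IsTypeDist D p) (t : ℕ) :
    IsTypeDist (nseq D t) p := by
  intro a
  obtain ⟨k, hk⟩ := h a
  refine ⟨k * (t + 1), ?_⟩
  unfold RGV.nseq
  push_cast
  rw [← hk]
  ring

lemma tendsto_lrate {n : ℕ → ℕ} {p u v : ℕ → ℝ} {e : ℝ} (hn : ∀ t, 0 < n t)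
    (hv : ∀ t, 0 < v t) (hu : ∀ t, 0 < u t)
    (hu0 : Tendsto (fun t => Real.log (u t) / n t) atTop (nhds 0))
    (hv0 : Tendsto (fun t => Real.log (v t) / n t) atTop (nhds 0))
    (hle : ∀ᶠ t in atTop, p t ≤ u t * Real.exp (n t * e))
    (hge : ∀ᶠ t in atTop, Real.exp (n t * e) ≤ v t * p t) :
    Tendsto (fun t => lrate (n t) (p t)) atTop (nhds (e : EReal)) := by
  have hpos : ∀ᶠ t in atTop, 0 < p t := by
    filter_upwards [hge] with t ht
    exact pos_of_mul_pos_right ((Real.exp_pos _).trans_le ht) (hv t).le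
  have hreal : Tendsto (fun t => Real.log (p t) / n t) atTop (nhds e) := by
    have hlow : Tendsto (fun t => e - Real.log (v t) / n t) atTop (nhds e) := by
      simpa using hv0.const_sub e
    have hup : Tendsto (fun t => Real.log (u t) / n t + e) atTop (nhds e) := by
      simpa using hu0.add_const e
    refine tendsto_of_tendsto_of_tendsto_of_le_of_le' hlow hup ?_ ?_
    · filter_upwards [hge, hpos] with t ht hp
      have hn' : (0 : ℝ) < n t := by exact_mod_cast hn t
      have h := Real.log_le_log (Real.exp_pos _) ht
      rw [Real.log_exp, Real.log_mul (hv t).ne' hp.ne'] at h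
      rw [sub_le_iff_le_add, ← add_div, le_div_iff₀ hn']
      linarith
    · filter_upwards [hle, hpos] with t ht hp
      have hn' : (0 : ℝ) < n t := by exact_mod_cast hn t
      have h := Real.log_le_log hp ht
      rw [Real.log_mul (hu t).ne' (Real.exp_pos _).ne', Real.log_exp] at h
      rw [div_le_iff₀ hn', add_mul, div_mul_cancel₀ _ hn'.ne']
      linarith
  refine ((continuous_coe_real_ereal.tendsto e).comp hreal).congr' ?_
  filter_upwards [hpos] with t hp
  simp only [Function.comp_apply, lrate, if_neg (not_le.2 hp)]

lemma tendsto_lrate_bot {n : ℕ → ℕ} {p : ℕ → ℝ} {ε : ℝ} (hn : ∀ t, 0 < n t) (hε : 0 < ε)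
    (h : ∀ k : ℕ, ∀ᶠ t in atTop, p t ≤ Real.exp (-(n t * ε)) ^ k) :
    Tendsto (fun t => lrate (n t) (p t)) atTop (nhds ⊥) := by
  rw [EReal.tendsto_nhds_bot_iff_real]
  intro x
  obtain ⟨k, hk⟩ := exists_nat_gt (-x / ε)
  rw [div_lt_iff₀ hε] at hk
  filter_upwards [h k] with t ht
  unfold lrate
  split_ifs with hp
  · exact EReal.bot_lt_coe x
  · have hn' : (0 : ℝ) < n t := by exact_mod_cast hn t
    have hlog := Real.log_le_log (not_le.1 hp) ht
    rw [Real.log_pow, Real.log_exp] at hlog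
    rw [EReal.coe_lt_coe_iff, div_lt_iff₀ hn']
    nlinarith

end Asymptotics
end RGV

open RGV in
/-- Large-deviations behaviour of the type enumerator: for
`s < [2R − I]₊` the probability `P[N ≥ e^{ns}]` is exponentially `e^{−n[I−2R]₊}`, and for
`s > [2R − I]₊` it decays super-exponentially. -/
theorem statement15 {α : Type} [Fintype α] [Nonempty α]
    (Q : α → ℝ) (D : ℕ) (hD : 0 < D) (hQ : IsDist Q) (hQD : IsTypeDist D Q)
    (d : (α × α → ℝ) → ℝ) (hd : IsDistance d) (Δ : ℝ)
    (R δ : ℝ) (hR : 0 < R) (hδ : 0 < δ)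
    (P : α × α → ℝ) (hP : Joint Q P) (hPD : IsTypeDist D P) (hPd : Δ < d P)
    (hrate : ∀ t : ℕ, RateCond (nseq D t) Q d Δ R δ) :
    ∀ s : ℝ,
      (s < pos (2 * R - mutInf P) →
        Filter.Tendsto
          (fun t : ℕ => lrate (nseq D t)
            (prob (nseq D t) Q d Δ (Mof R (nseq D t))
              (fun c => Real.exp ((nseq D t : ℝ) * s) ≤ ((Nenum (nseq D t) P c : ℕ) : ℝ))))
          Filter.atTop (nhds (((-pos (mutInf P - 2 * R) : ℝ)) : EReal))) ∧
      (pos (2 * R - mutInf P) < s →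
        Filter.Tendsto
          (fun t : ℕ => lrate (nseq D t)
            (prob (nseq D t) Q d Δ (Mof R (nseq D t))
              (fun c => Real.exp ((nseq D t : ℝ) * s) ≤ ((Nenum (nseq D t) P c : ℕ) : ℝ))))
          Filter.atTop (nhds (⊥ : EReal))) := by
  intro s
  have hn := nseq_pos hD
  have hlim := tendsto_nseq hD
  have hbig : ∀ᶠ t in atTop,
      24 * polyFactor α (nseq D t) ≤ Real.exp (nseq D t * (2 * δ)) :=
    hlim.eventually (eventually_polyFactor_le_exp α (by norm_num) (by linarith))
  have hπ : ∀ n, 0 < polyFactor α n := fun n => zero_lt_one.trans_le (one_le_polyFactor α n)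
  constructor
  · intro hs
    refine tendsto_lrate (u := fun t => 16 * polyFactor α (nseq D t) ^ 1)
      (v := fun t => 2 ^ 17 * polyFactor α (nseq D t) ^ 4) hn
      (fun t => by have := hπ (nseq D t); positivity)
      (fun t => by have := hπ (nseq D t); positivity)
      ((tendsto_log_polyFactor_div α (by norm_num) 1).comp hlim)
      ((tendsto_log_polyFactor_div α (by norm_num) 4).comp hlim) ?_ ?_
    · filter_upwards [hbig] with t ht
      rw [pow_one]
      exact prob_nenum_le (hn t) hQ (hQD.nseq t) hd hR (hrate t) hP ht s
    · have hs' : ∀ᶠ t in atTop, s < 0 ∨ 16 * polyFactor α (nseq D t) *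
          Real.exp (nseq D t * s) ≤ Real.exp (nseq D t * (2 * R - mutInf P)) := by
        rcases lt_max_iff.1 hs with h | h
        · filter_upwards [hlim.eventually (eventually_polyFactor_le_exp α (C := 16)
            (by norm_num) (sub_pos.2 h))] with t ht
          right
          refine (mul_le_mul_of_nonneg_right ht (Real.exp_pos _).le).trans (le_of_eq ?_)
          rw [← Real.exp_add]
          congr 1
          ring
        · exact Eventually.of_forall fun t => Or.inl h
      filter_upwards [hbig, hs'] with t ht hst
      exact le_prob_nenum (hn t) hQ (hQD.nseq t) hd hR (hrate t) hP (hPD.nseq t) hPd ht hst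
  · intro hs
    refine tendsto_lrate_bot hn (half_pos (sub_pos.2 hs)) fun k => ?_
    filter_upwards [hbig, hlim.eventually (eventually_polyFactor_le_exp α
      (C := 16 * (1 + (k : ℝ) ^ 2)) (by positivity) (half_pos (sub_pos.2 hs)))] with t ht hk
    refine (prob_nenum_le_pow (hn t) hQ (hQD.nseq t) hd hR (hrate t) hP ht s k).trans ?_
    have := hπ (nseq D t)
    refine pow_le_pow_left₀ (by positivity) ?_ k
    refine (mul_le_mul_of_nonneg_right hk (Real.exp_pos _).le).trans (le_of_eq ?_)
    rw [← Real.exp_add]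
    congr 1
    ring
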